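/- arXiv:1805.02086 — 3 statements merged into one kernel-verified Lean document; each statement's English description precedes it below -/
import Mathlib

section
/- Let n ≥ 2, let q ∈ ℂⁿ and let ε > 0. The set of automorphisms f ∈ Aut_{ω₀}(ℂⁿ) having a hyperbolic fixed point p whose stable manifold Σ_f(p) intersects the open ball B(q, ε) is dense in Aut_{ω₀}(ℂⁿ). -/
open Topology Filter Metric Set Function

noncomputable section

/-- ℂⁿ with the Euclidean norm. -/
abbrev En (n : ℕ) : Type := EuclideanSpace ℂ (Fin n)

/-- A holomorphic automorphism of ℂⁿ: a bijection that is holomorphic with holomorphic inverse. -/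
def IsHoloAut {n : ℕ} (f : En n → En n) : Prop :=
  Differentiable ℂ f ∧ ∃ g : En n → En n, Differentiable ℂ g ∧
    Function.LeftInverse g f ∧ Function.RightInverse g f

/-- Volume-preserving with respect to ω₀ = dz₁∧⋯∧dzₙ: det Df(z) = 1 for all z. -/
def IsVolPres {n : ℕ} (f : En n → En n) : Prop :=
  ∀ z : En n, (fderiv ℂ f z).det = 1

/-- Aut(ℂⁿ) as a subset of C(ℂⁿ, ℂⁿ) with the compact-open topology. -/
def AutCN (n : ℕ) : Set C(En n, En n) := {f | IsHoloAut ⇑f}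

/-- Aut_{ω₀}(ℂⁿ) as a subset of C(ℂⁿ, ℂⁿ) with the compact-open topology. -/
def AutOmega (n : ℕ) : Set C(En n, En n) := {f | IsHoloAut ⇑f ∧ IsVolPres ⇑f}

/-- A continuous self-map is chaotic if it has a dense forward orbit and its set of
periodic points is dense. -/
def Chaotic {α : Type*} [TopologicalSpace α] (f : α → α) : Prop :=
  (∃ x : α, Dense (Set.range fun k : ℕ => f^[k] x)) ∧
  Dense {x : α | ∃ k : ℕ, 0 < k ∧ f^[k] x = x}

/-- Expelling: the set of points with unbounded forward orbit is dense. -/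
def Expelling {n : ℕ} (f : En n → En n) : Prop :=
  Dense {x : En n | ¬ Bornology.IsBounded (Set.range fun k : ℕ => f^[k] x)}

/-- p is a hyperbolic fixed point of f: f(p) = p and no eigenvalue of Df(p) has modulus 1. -/
def HypFixedPt {n : ℕ} (f : En n → En n) (p : En n) : Prop :=
  f p = p ∧ ∀ μ : ℂ, Module.End.HasEigenvalue
    ((fderiv ℂ f p : En n →ₗ[ℂ] En n) : Module.End ℂ (En n)) μ → ‖μ‖ ≠ 1

/-- The stable manifold of a fixed point p of f: points whose forward orbit tends to p. -/
def StableSet {n : ℕ} (f : En n → En n) (p : En n) : Set (En n) :=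
  {x : En n | Tendsto (fun k : ℕ => f^[k] x) atTop (𝓝 p)}

theorem cau1 {n : ℕ} {F : Type*} [NormedAddCommGroup F] [NormedSpace ℂ F] {u : En n → F}
    (hu : Differentiable ℂ u) {c : En n} {r C : ℝ} (hr : 0 < r)
    (h : ∀ z ∈ ball c r, ‖u z‖ ≤ C) : ‖fderiv ℂ u c‖ ≤ 2 * C / r := by
  refine Complex.norm_fderiv_le_div_of_mapsTo_ball (R₂ := 2 * C) hu.differentiableOn ?_ hr
  intro z hz
  rw [mem_closedBall, dist_eq_norm]
  have h1 := h z hz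
  have h2 := h c (mem_ball_self hr)
  linarith [norm_sub_le (u z) (u c)]

theorem cau2 {n : ℕ} {F : Type*} [NormedAddCommGroup F] [NormedSpace ℂ F] {u : En n → F}
    (hu : Differentiable ℂ u) {x0 : En n} {ρ C : ℝ} (hr : 0 < ρ)
    (h : ∀ z ∈ ball x0 ρ, ‖u z‖ ≤ C) {x y : En n} (hx : x ∈ ball x0 (ρ/4)) (hy : y ∈ ball x0 (ρ/4)) :
    ‖fderiv ℂ u y - fderiv ℂ u x‖ ≤ 32 * C / ρ^2 * ‖y - x‖ := by
  have hb : ∀ z ∈ ball x0 (ρ/2), ‖fderiv ℂ u z‖ ≤ 4 * C / ρ := by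
    intro z hz
    have := cau1 hu (c := z) (r := ρ/2) (C := C) (by positivity) (by
      intro w hw; apply h; rw [mem_ball] at *; linarith [dist_triangle w z x0])
    refine this.trans (le_of_eq ?_); field_simp; ring
  set δ := y - x with hδ
  let w : En n → F := fun z => u (z + δ) - u z
  have hw : Differentiable ℂ w := by
    intro z
    exact ((hu (z+δ)).comp z (by fun_prop : DifferentiableAt ℂ (fun z => z + δ) z)).sub (hu z)
  have hfd : fderiv ℂ w x = fderiv ℂ u y - fderiv ℂ u x := by
    have h1 : HasFDerivAt (fun z => u (z + δ)) (fderiv ℂ u (x + δ)) x := by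
      have := (hu (x+δ)).hasFDerivAt.comp x ((hasFDerivAt_id x).add_const δ)
      simpa [Function.comp_def] using this
    have : x + δ = y := by rw [hδ]; abel
    rw [this] at h1
    exact (h1.sub (hu x).hasFDerivAt).fderiv
  rw [← hfd]
  have := cau1 hw (c := x) (r := ρ/4) (C := 4 * C / ρ * ‖δ‖) (by positivity) (by
    intro z hz
    have h1 : z ∈ ball x0 (ρ/2) := by
      rw [mem_ball] at *; linarith [dist_triangle z x x0]
    have h2 : z + δ ∈ ball x0 (ρ/2) := by
      have : dist (z+δ) y = dist z x := by
        rw [hδ, dist_eq_norm, dist_eq_norm]; congr 1; abel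
      rw [mem_ball] at *; linarith [dist_triangle (z+δ) y x0]
    have := (convex_ball x0 (ρ/2)).norm_image_sub_le_of_norm_fderiv_le (𝕜 := ℂ) (fun x _ => hu x) hb h1 h2
    simpa [w] using this)
  refine this.trans (le_of_eq ?_); field_simp; ring

theorem cau3 {n : ℕ} {F : Type*} [NormedAddCommGroup F] [NormedSpace ℂ F] {u : En n → F}
    (hu : Differentiable ℂ u) {x0 : En n} {ρ C : ℝ} (hr : 0 < ρ)
    (h : ∀ z ∈ ball x0 ρ, ‖u z‖ ≤ C) {x y : En n} (hx : x ∈ ball x0 (ρ/4)) (hy : y ∈ ball x0 (ρ/4)) :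
    ‖u y - u x - fderiv ℂ u x (y - x)‖ ≤ 32 * C / ρ^2 * ‖y - x‖^2 := by
  have hC : 0 ≤ C := (norm_nonneg _).trans (h x0 (mem_ball_self hr))
  have := (convex_segment x y).norm_image_sub_le_of_norm_fderiv_le' (𝕜 := ℂ)
    (C := 32 * C / ρ^2 * ‖y - x‖) (φ := fderiv ℂ u x) (fun x _ => hu x) (by
    intro z hz
    have hz' := (convex_ball x0 (ρ/4)).segment_subset hx hy hz
    refine (cau2 hu hr h hx hz').trans ?_
    have : ‖z - x‖ ≤ ‖y - x‖ := by
      obtain ⟨t, ht, rfl⟩ := (segment_eq_image' ℝ x y ▸ hz)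
      simp only [add_sub_cancel_left, norm_smul, Real.norm_eq_abs, abs_of_nonneg ht.1]
      exact mul_le_of_le_one_left (norm_nonneg _) ht.2
    gcongr) (left_mem_segment ℝ x y) (right_mem_segment ℝ x y)
  refine this.trans (le_of_eq ?_); ring

theorem bdd_ball {n : ℕ} {F : Type*} [NormedAddCommGroup F] {u : En n → F} (hu : Continuous u)
    (x0 : En n) (ρ : ℝ) : ∃ C, 0 < C ∧ ∀ z ∈ closedBall x0 ρ, ‖u z‖ ≤ C := by
  obtain ⟨C, hC⟩ := (isCompact_closedBall x0 ρ).exists_bound_of_continuousOn hu.continuousOn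
  exact ⟨max C 1, by positivity, fun z hz => (hC z hz).trans (le_max_left _ _)⟩

theorem fderiv_cont {n : ℕ} {F : Type*} [NormedAddCommGroup F] [NormedSpace ℂ F] {u : En n → F}
    (hu : Differentiable ℂ u) : Continuous (fderiv ℂ u) := by
  rw [continuous_iff_continuousAt]
  intro x
  obtain ⟨C, hC0, hC⟩ := bdd_ball hu.continuous x 1
  have : ∀ y ∈ ball x (1/4), dist (fderiv ℂ u y) (fderiv ℂ u x) ≤ 32 * C * ‖y - x‖ := by
    intro y hy
    have := cau2 hu (x0 := x) (ρ := 1) (C := C) one_pos (fun z hz => hC z (ball_subset_closedBall hz))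
      (mem_ball_self (by norm_num)) hy
    rw [dist_eq_norm]; simpa using this
  rw [ContinuousAt, tendsto_iff_dist_tendsto_zero]
  refine squeeze_zero' (Eventually.of_forall fun _ => dist_nonneg)
    (Filter.mem_of_superset (ball_mem_nhds x (by norm_num : (0:ℝ) < 1/4)) this) ?_
  have : Continuous fun y => 32 * C * ‖y - x‖ := by fun_prop
  simpa using this.tendsto x

theorem entire_contDiff {n : ℕ} {F : Type*} [NormedAddCommGroup F] [NormedSpace ℂ F] {u : En n → F}
    (hu : Differentiable ℂ u) : ContDiff ℂ 1 u :=
  contDiff_one_iff_fderiv.2 ⟨hu, fderiv_cont hu⟩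

/-- directional derivatives of entire maps are entire -/
theorem dirDeriv_entire {n : ℕ} {F : Type*} [NormedAddCommGroup F] [NormedSpace ℂ F] [CompleteSpace F]
    {u : En n → F} (hu : Differentiable ℂ u) (v : En n) :
    Differentiable ℂ (fun z => fderiv ℂ u z v) := by
  have hrep : (fun z => fderiv ℂ u z v) = fun z =>
      (2 * Real.pi * Complex.I : ℂ)⁻¹ • ∫ θ in (0:ℝ)..2 * Real.pi,
        (deriv (circleMap 0 1) θ * ((circleMap 0 1 θ - 0) ^ 2)⁻¹) • u (z + circleMap 0 1 θ • v) := by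
    funext z
    have hd : Differentiable ℂ (fun t : ℂ => u (z + t • v)) := hu.comp (by fun_prop)
    have h1 := Complex.two_pi_I_inv_smul_circleIntegral_sub_sq_inv_smul_of_differentiable
      (U := univ) isOpen_univ (c := 0) (w₀ := 0) (R := 1) (subset_univ _) hd.differentiableOn (by simp)
    have h2 : deriv (fun t : ℂ => u (z + t • v)) 0 = fderiv ℂ u z v := by
      have ha : HasDerivAt (fun t : ℂ => z + t • v) v 0 := by
        simpa using ((hasDerivAt_id (0:ℂ)).smul_const v).const_add z
      have hb : HasFDerivAt u (fderiv ℂ u z) (z + (0:ℂ) • v) := by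
        simpa using (hu z).hasFDerivAt
      exact (hb.comp_hasDerivAt 0 ha).deriv
    rw [← h2, ← h1, circleIntegral]
    simp only [smul_smul, smul_eq_mul]
  rw [hrep]
  intro x
  apply DifferentiableAt.const_smul
  have hcont : Continuous fun θ : ℝ => (deriv (circleMap 0 1) θ * ((circleMap 0 1 θ - 0) ^ 2)⁻¹ : ℂ) := by
    have : Continuous fun θ : ℝ => (circleMap 0 1 θ - 0 : ℂ) ^ 2 := by fun_prop
    have h2 : Continuous fun θ : ℝ => deriv (circleMap 0 1) θ := by
      simp only [deriv_circleMap]; fun_prop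
    exact h2.mul (this.inv₀ (by intro θ; simp))
  have hcm : Continuous (circleMap 0 1) := by fun_prop
  have hF : ∀ z, Continuous fun θ : ℝ => (deriv (circleMap 0 1) θ * ((circleMap 0 1 θ - 0) ^ 2)⁻¹ : ℂ) • u (z + circleMap 0 1 θ • v) := 
    fun z => hcont.smul (hu.continuous.comp (by fun_prop))
  have hfc := fderiv_cont hu
  obtain ⟨C, hC0, hC⟩ := bdd_ball hfc x (1 + ‖v‖)
  have := intervalIntegral.hasFDerivAt_integral_of_dominated_of_fderiv_le (𝕜 := ℂ) (μ := MeasureTheory.volume)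
    (a := 0) (b := 2 * Real.pi) (bound := fun _ => C) (s := ball x 1) (x₀ := x)
    (F := fun z θ => (deriv (circleMap 0 1) θ * ((circleMap 0 1 θ - 0) ^ 2)⁻¹ : ℂ) • u (z + circleMap 0 1 θ • v))
    (F' := fun z θ => (deriv (circleMap 0 1) θ * ((circleMap 0 1 θ - 0) ^ 2)⁻¹ : ℂ) • fderiv ℂ u (z + circleMap 0 1 θ • v))
    (ball_mem_nhds x one_pos) (Eventually.of_forall fun z => (hF z).aestronglyMeasurable)
    ((hF x).intervalIntegrable _ _) ((hcont.smul (hfc.comp (by fun_prop))).aestronglyMeasurable)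
    (Eventually.of_forall fun θ _ z hz => by
      rw [norm_smul]
      have : ‖(deriv (circleMap 0 1) θ * ((circleMap 0 1 θ - 0) ^ 2)⁻¹ : ℂ)‖ = 1 := by simp
      rw [this, one_mul]
      apply hC
      rw [mem_closedBall, dist_eq_norm]
      have h1 : ‖z - x‖ < 1 := by simpa [dist_eq_norm] using hz
      have h2 : ‖circleMap 0 1 θ • v‖ = ‖v‖ := by rw [norm_smul]; simp
      calc _ = ‖(z - x) + circleMap 0 1 θ • v‖ := by congr 1; abel
        _ ≤ _ := by linarith [norm_add_le (z - x) (circleMap 0 1 θ • v)])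
    (by simp)
    (Eventually.of_forall fun θ _ z hz => by
      apply HasFDerivAt.const_smul
      have := (hu (z + circleMap 0 1 θ • v)).hasFDerivAt.comp z ((hasFDerivAt_id z).add_const (circleMap 0 1 θ • v))
      simpa [Function.comp_def] using this)
  exact this.differentiableAt

theorem clm_sum {n : ℕ} {F : Type*} [NormedAddCommGroup F] [NormedSpace ℂ F] (A : En n →L[ℂ] F) (z : En n) :
    A z = ∑ a, z a • A (EuclideanSpace.single a 1) := by
  conv_lhs => rw [← (EuclideanSpace.basisFun (Fin n) ℂ).sum_repr z]
  rw [map_sum]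
  simp

/-- the exponential of a functional, as a continuous map -/
noncomputable def expC {n : ℕ} (l : En n →L[ℂ] ℂ) : C(En n, ℂ) :=
  ⟨fun z => Complex.exp (l z), by fun_prop⟩

noncomputable def expAlg (n : ℕ) : Subalgebra ℂ C(En n, ℂ) :=
  (Algebra.adjoin ℂ (range (expC (n := n)))).topologicalClosure

theorem lin_mem_expAlg {n : ℕ} (l : En n →L[ℂ] ℂ) :
    (⟨fun z => l z, l.continuous⟩ : C(En n, ℂ)) ∈ expAlg n := by
  let s : ℕ → ℂ := fun k => 1 / ((k:ℂ) + 1)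
  have hs : ∀ k, s k ≠ 0 := fun k => by
    have : (k:ℂ) + 1 ≠ 0 := by exact_mod_cast Nat.succ_ne_zero k
    exact one_div_ne_zero this
  have hs0 : Tendsto s atTop (𝓝 0) := tendsto_one_div_add_atTop_nhds_zero_nat
  have hcl : IsClosed ((expAlg n : Subalgebra ℂ C(En n, ℂ)) : Set C(En n, ℂ)) :=
    Subalgebra.isClosed_topologicalClosure _
  let g : ℕ → C(En n, ℂ) := fun k => (s k)⁻¹ • (expC (s k • l) - 1)
  refine hcl.mem_of_tendsto (f := g) (b := atTop) ?_ (Eventually.of_forall fun k => ?_)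
  · rw [ContinuousMap.tendsto_iff_forall_isCompact_tendstoUniformlyOn]
    intro K hK
    obtain ⟨C, hC⟩ := hK.exists_bound_of_continuousOn l.continuous.continuousOn
    rw [Metric.tendstoUniformlyOn_iff]
    intro ε hε
    have h1 : Tendsto (fun k => ‖s k‖ * (max C 0)) atTop (𝓝 0) := by
      simpa using hs0.norm.mul_const (max C 0)
    have h2 : Tendsto (fun k => ‖s k‖ * (max C 0)^2) atTop (𝓝 0) := by
      simpa using hs0.norm.mul_const ((max C 0)^2)
    filter_upwards [h1.eventually (gt_mem_nhds one_pos), h2.eventually (gt_mem_nhds hε)] with k hk1 hk2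
    intro z hz
    have hz1 : ‖l z‖ ≤ max C 0 := (hC z hz).trans (le_max_left _ _)
    have hw : ‖s k * l z‖ ≤ 1 := by
      rw [norm_mul]; exact (mul_le_mul_of_nonneg_left hz1 (norm_nonneg _)).trans hk1.le
    have := Complex.norm_exp_sub_one_sub_id_le hw
    have e : l z - (g k) z = -((s k)⁻¹ * (Complex.exp (s k * l z) - 1 - s k * l z)) := by
      have : (g k) z = (s k)⁻¹ * (Complex.exp (s k * l z) - 1) := by simp [g, expC]
      rw [this]; field_simp [hs k]; ring
    rw [dist_eq_norm]
    change ‖l z - (g k) z‖ < ε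
    rw [e, norm_neg, norm_mul, norm_inv]
    have hsp : 0 < ‖s k‖ := norm_pos_iff.2 (hs k)
    calc _ ≤ ‖s k‖⁻¹ * ‖s k * l z‖^2 := by gcongr
      _ = ‖s k‖ * ‖l z‖^2 := by rw [norm_mul]; field_simp
      _ ≤ ‖s k‖ * (max C 0)^2 := by gcongr
      _ < ε := hk2
  · apply Subalgebra.le_topologicalClosure
    apply Subalgebra.smul_mem
    exact Subalgebra.sub_mem _ (Algebra.subset_adjoin ⟨_, rfl⟩) (Subalgebra.one_mem _)

theorem taylor_mem {n : ℕ} (k : ℕ) : ∀ u : En n → ℂ, Differentiable ℂ u →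
    ∃ p ∈ expAlg n, ∀ z, p z = iteratedDeriv k (fun t : ℂ => u (t • z)) 0 := by
  induction k with
  | zero => 
    intro u hu
    refine ⟨algebraMap ℂ _ (u 0), Subalgebra.algebraMap_mem _ _, fun z => ?_⟩
    simp
  | succ k ih =>
    intro u hu
    choose p hp hpe using fun a : Fin n => ih _ (dirDeriv_entire hu (EuclideanSpace.single a 1))
    refine ⟨∑ a, (⟨fun z => EuclideanSpace.proj (𝕜 := ℂ) a z, (EuclideanSpace.proj (𝕜 := ℂ) a).continuous⟩ : C(En n, ℂ)) * p a,
      Subalgebra.sum_mem _ fun a _ => Subalgebra.mul_mem _ (lin_mem_expAlg _) (hp a), fun z => ?_⟩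
    rw [iteratedDeriv_succ']
    have : deriv (fun t : ℂ => u (t • z)) = fun t => ∑ a, z a * fderiv ℂ u (t • z) (EuclideanSpace.single a 1) := by
      funext t
      have ha : HasDerivAt (fun t : ℂ => t • z) z t := by
        simpa using ((hasDerivAt_id t).smul_const z)
      have hb : deriv (fun t : ℂ => u (t • z)) t = fderiv ℂ u (t • z) z :=
        ((hu (t • z)).hasFDerivAt.comp_hasDerivAt t ha).deriv
      rw [hb]
      rw [clm_sum]
      simp
    rw [this, iteratedDeriv_fun_sum]
    · simp only [iteratedDeriv_const_mul_field, ContinuousMap.coe_sum, Finset.sum_apply, ContinuousMap.mul_apply, hpe]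
      rfl
    · intro a _
      have : Differentiable ℂ fun t : ℂ => z a * fderiv ℂ u (t • z) (EuclideanSpace.single a 1) :=
        ((dirDeriv_entire hu (EuclideanSpace.single a 1)).comp
          (by fun_prop : Differentiable ℂ fun t : ℂ => t • z)).const_mul _
      exact this.contDiff.contDiffAt

theorem entire_mem {n : ℕ} (u : En n → ℂ) (hu : Differentiable ℂ u) :
    (⟨u, hu.continuous⟩ : C(En n, ℂ)) ∈ expAlg n := by
  choose p hp hpe using fun k => taylor_mem k u hu
  have hcl : IsClosed ((expAlg n : Subalgebra ℂ C(En n, ℂ)) : Set C(En n, ℂ)) :=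
    Subalgebra.isClosed_topologicalClosure _
  refine hcl.mem_of_tendsto (f := fun t : Finset ℕ => ∑ k ∈ t, ((k.factorial : ℂ)⁻¹) • p k) (b := atTop) ?_
    (Eventually.of_forall fun t => Subalgebra.sum_mem _ fun k _ => Subalgebra.smul_mem _ (hp k) _)
  rw [ContinuousMap.tendsto_iff_forall_isCompact_tendstoUniformlyOn]
  intro K hK
  obtain ⟨R, hR⟩ := hK.isBounded.subset_closedBall 0
  obtain ⟨C, hC0, hC⟩ := bdd_ball hu.continuous 0 (2 * R)
  have hd : ∀ z, Differentiable ℂ fun t : ℂ => u (t • z) := fun z => hu.comp (by fun_prop)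
  have := tendstoUniformlyOn_tsum (f := fun k z => ((k.factorial : ℂ)⁻¹) * p k z) (s := K)
    (u := fun k => C * (1/2:ℝ)^k) (summable_geometric_two.mul_left C) (by
      intro k z hz
      have h1 := Complex.norm_iteratedDeriv_le_of_forall_mem_sphere_norm_le (c := 0) (R := 2) (C := C) k two_pos
        (hd z).diffContOnCl (by
          intro t ht
          apply hC
          have h2 : ‖z‖ ≤ R := by simpa using hR hz
          have h3 : ‖t‖ = 2 := by simpa using ht
          rw [mem_closedBall_zero_iff, norm_smul, h3]; linarith)
      rw [hpe, norm_mul, norm_inv, Complex.norm_natCast]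
      have hf : (0:ℝ) < k.factorial := by exact_mod_cast k.factorial_pos
      calc _ ≤ (k.factorial:ℝ)⁻¹ * (k.factorial * C / 2^k) := by gcongr
        _ = _ := by rw [one_div, inv_pow]; field_simp)
  have e : ∀ z, u z = ∑' k, ((k.factorial : ℂ)⁻¹) * p k z := by
    intro z
    have := Complex.taylorSeries_eq_of_entire (hd z) 0 1
    simp only [sub_zero, one_pow, one_smul, smul_eq_mul, one_mul] at this
    rw [← this]; simp only [hpe]
  simp only [← e] at this
  convert this using 2 with t
  · simp
  · rfl

theorem exp_approx {n : ℕ} (u : En n → ℂ) (hu : Differentiable ℂ u) (R δ : ℝ) (hδ : 0 < δ) :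
    ∃ P ∈ Submodule.span ℂ (range fun (l : En n →L[ℂ] ℂ) => fun z : En n => Complex.exp (l z)),
      ∀ z ∈ closedBall (0 : En n) R, ‖u z - P z‖ < δ := by
  have h := entire_mem u hu
  rw [expAlg, ← SetLike.mem_coe, Subalgebra.topologicalClosure_coe, UniformSpace.mem_closure_iff_ball] at h
  have hV : {fg : C(En n, ℂ) × C(En n, ℂ) | ∀ x ∈ closedBall (0 : En n) R, (fg.1 x, fg.2 x) ∈ {p : ℂ × ℂ | dist p.1 p.2 < δ}} ∈ uniformity C(En n, ℂ) :=
    ContinuousMap.hasBasis_compactConvergenceUniformity.mem_of_mem (i := (closedBall (0 : En n) R, {p : ℂ × ℂ | dist p.1 p.2 < δ}))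
      ⟨isCompact_closedBall _ _, Metric.dist_mem_uniformity hδ⟩
  obtain ⟨P, hP1, hP2⟩ := h hV
  refine ⟨P, ?_, fun z hz => ?_⟩
  · have h1 : P ∈ Subalgebra.toSubmodule (Algebra.adjoin ℂ (range (expC (n := n)))) := hP2
    rw [Algebra.adjoin_eq_span] at h1
    have h2 : (Submonoid.closure (range (expC (n := n))) : Set C(En n, ℂ)) = range (expC (n := n)) := by
      let S : Submonoid C(En n, ℂ) := 
        { carrier := range expC
          mul_mem' := by
            rintro _ _ ⟨a, rfl⟩ ⟨b, rfl⟩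
            exact ⟨a + b, by ext z; simp [expC, Complex.exp_add]⟩
          one_mem' := ⟨0, by ext z; simp [expC]⟩ }
      exact congrArg SetLike.coe (Submonoid.closure_eq S)
    rw [h2] at h1
    have h3 := Submodule.mem_map_of_mem (f := (ContinuousMap.coeFnLinearMap ℂ : C(En n, ℂ) →ₗ[ℂ] (En n → ℂ))) h1
    rw [Submodule.map_span, ← range_comp] at h3
    exact h3
  · have := hP1 z hz
    simpa [dist_eq_norm] using this

def VAut {n : ℕ} (f : En n → En n) : Prop := IsHoloAut f ∧ IsVolPres f

theorem VAut.diff {n : ℕ} {f : En n → En n} (hf : VAut f) : Differentiable ℂ f := hf.1.1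

theorem VAut.inj {n : ℕ} {f : En n → En n} (hf : VAut f) : Injective f := by
  obtain ⟨_, g, _, h, _⟩ := hf.1
  exact h.injective

theorem VAut.comp {n : ℕ} {f g : En n → En n} (hf : VAut f) (hg : VAut g) : VAut (f ∘ g) := by
  obtain ⟨hf1, f', hf2, hf3, hf4⟩ := hf.1
  obtain ⟨hg1, g', hg2, hg3, hg4⟩ := hg.1
  refine ⟨⟨hf1.comp hg1, g' ∘ f', hg2.comp hf2, hf3.comp hg3, hf4.comp hg4⟩, fun z => ?_⟩
  rw [fderiv_comp z (hf1 _) (hg1 _)]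
  have := hf.2 (g z)
  have h2 := hg.2 z
  simp only [ContinuousLinearMap.det, ContinuousLinearMap.toLinearMap_comp, LinearMap.det_comp] at *
  rw [this, h2, one_mul]

theorem VAut.idd {n : ℕ} : VAut (id : En n → En n) := by
  refine ⟨⟨differentiable_id, id, differentiable_id, fun _ => rfl, fun _ => rfl⟩, fun z => ?_⟩
  rw [fderiv_id]
  simp [ContinuousLinearMap.det]

theorem VAut.iterate {n : ℕ} {f : En n → En n} (hf : VAut f) (k : ℕ) : VAut (f^[k]) := by
  induction k with
  | zero => exact VAut.idd
  | succ k ih => rw [iterate_succ]; exact ih.comp hf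

theorem VAut.exists_inv {n : ℕ} {f : En n → En n} (hf : VAut f) :
    ∃ g, VAut g ∧ LeftInverse g f ∧ RightInverse g f := by
  obtain ⟨hf1, g, hf2, hf3, hf4⟩ := hf.1
  refine ⟨g, ⟨⟨hf2, f, hf1, hf4, hf3⟩, fun z => ?_⟩, hf3, hf4⟩
  have h1 : fderiv ℂ (f ∘ g) z = ContinuousLinearMap.id ℂ _ := by
    have : f ∘ g = id := funext hf4
    rw [this, fderiv_id]
  rw [fderiv_comp z (hf1 _) (hf2 _)] at h1
  have h2 := congrArg ContinuousLinearMap.det h1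
  have h3 := hf.2 (g z)
  simp only [ContinuousLinearMap.det, ContinuousLinearMap.toLinearMap_comp, LinearMap.det_comp] at *
  rw [h3, one_mul] at h2
  rw [h2]; simp

theorem shear_hasFDerivAt {n : ℕ} (l : En n →L[ℂ] ℂ) (v : En n) {h : ℂ → ℂ}
    (hh : Differentiable ℂ h) (z : En n) :
    HasFDerivAt (fun z => z + h (l z) • v)
      (ContinuousLinearMap.id ℂ (En n) + deriv h (l z) • l.smulRight v) z := by
  have h1 : HasFDerivAt (fun z => h (l z)) (deriv h (l z) • l) z :=
    (hh (l z)).hasDerivAt.comp_hasFDerivAt z l.hasFDerivAt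
  have h2 := (hasFDerivAt_id z).add (h1.smul_const v)
  have e : ContinuousLinearMap.id ℂ (En n) + deriv h (l z) • l.smulRight v =
      ContinuousLinearMap.id ℂ (En n) + (deriv h (l z) • l).smulRight v := by
    ext w
    simp [mul_assoc]
  rw [e]
  exact h2

theorem shear_VAut {n : ℕ} (l : En n →L[ℂ] ℂ) (v : En n) (hlv : l v = 0) {h : ℂ → ℂ}
    (hh : Differentiable ℂ h) : VAut (fun z => z + h (l z) • v) := by
  refine ⟨⟨fun z => (shear_hasFDerivAt l v hh z).differentiableAt, fun z => z - h (l z) • v, ?_, ?_, ?_⟩, ?_⟩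
  · exact differentiable_id.sub ((hh.comp l.differentiable).smul_const v)
  · intro z; simp [hlv]
  · intro z; simp [hlv]
  · intro z
    rw [(shear_hasFDerivAt l v hh z).fderiv]
    have : ((ContinuousLinearMap.id ℂ (En n) + deriv h (l z) • l.smulRight v : En n →L[ℂ] En n) : En n →ₗ[ℂ] En n)
      = LinearMap.transvection (l : En n →ₗ[ℂ] ℂ) (deriv h (l z) • v) := by
      ext w : 1
      simp [LinearMap.transvection.apply]
      rw [smul_smul, smul_smul, mul_comm]
    rw [ContinuousLinearMap.det, this, LinearMap.transvection.det]
    simp [hlv]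

def Near {n : ℕ} (f : En n → En n) (R ε : ℝ) (G : En n → En n) : Prop :=
  ∀ z ∈ closedBall (0 : En n) R, dist (G z) (f z) < ε

theorem Near.perturb {n : ℕ} {f G : En n → En n} {R ε : ℝ} (hf : Continuous f) (hG : Continuous G)
    (h : Near f R ε G) : ∃ η > 0, ∀ φ : En n → En n, (∀ z ∈ closedBall (0 : En n) R, dist (φ z) z < η) →
      Near f R ε (G ∘ φ) := by
  by_cases hR : R < 0
  · refine ⟨1, one_pos, fun φ _ z hz => ?_⟩
    rw [closedBall_eq_empty.2 hR] at hz; exact hz.elim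
  push Not at hR
  have hK := isCompact_closedBall (0 : En n) R
  have hne : (closedBall (0 : En n) R).Nonempty := ⟨0, by simp [hR]⟩
  have hc : Continuous fun z => dist (G z) (f z) := hG.dist hf
  obtain ⟨z0, hz0, hmax⟩ := hK.exists_isMaxOn hne hc.continuousOn
  have hgap : 0 < ε - dist (G z0) (f z0) := sub_pos.2 (h z0 hz0)
  have hU := (isCompact_closedBall (0 : En n) (R+1)).uniformContinuousOn_of_continuous hG.continuousOn
  rw [Metric.uniformContinuousOn_iff] at hU
  obtain ⟨δ, hδ, hU⟩ := hU _ hgap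
  refine ⟨min δ 1, by positivity, fun φ hφ z hz => ?_⟩
  have h1 := hφ z hz
  have h2 : φ z ∈ closedBall (0 : En n) (R+1) := by
    rw [mem_closedBall] at *
    linarith [dist_triangle (φ z) z 0, min_le_right δ 1]
  have h3 := hU (φ z) h2 z (closedBall_subset_closedBall (by linarith) hz) (h1.trans_le (min_le_left _ _))
  have h4 : dist (G z) (f z) ≤ dist (G z0) (f z0) := hmax hz
  calc _ ≤ dist (G (φ z)) (G z) + dist (G z) (f z) := dist_triangle _ _ _
    _ < ε := by linarith

noncomputable def SN {n : ℕ} (f g : En n → En n) (X : En n → En n) (N : ℕ) (x : En n) : En n :=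
  ∑ j ∈ Finset.range N, fderiv ℂ (g^[j]) (f^[j] x) (X (f^[j] x))

theorem ID_eq {n : ℕ} {f g : En n → En n} (hf : Differentiable ℂ f) (hg : Differentiable ℂ g)
    (hgf : LeftInverse g f) (j : ℕ) (x : En n) :
    (fderiv ℂ (g^[j]) (f^[j] x)).comp (fderiv ℂ (f^[j]) x) = ContinuousLinearMap.id ℂ _ := by
  have h : g^[j] ∘ f^[j] = id := funext (hgf.iterate j)
  rw [← fderiv_comp x ((hg.iterate j) _) ((hf.iterate j) _), h, fderiv_id]

theorem DI_eq {n : ℕ} {f g : En n → En n} (hf : Differentiable ℂ f) (hg : Differentiable ℂ g)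
    (hgf : LeftInverse g f) (hfg : RightInverse g f) (j : ℕ) (x : En n) :
    (fderiv ℂ (f^[j]) x).comp (fderiv ℂ (g^[j]) (f^[j] x)) = ContinuousLinearMap.id ℂ _ := by
  have := ID_eq hg hf hfg j (f^[j] x)
  rwa [hgf.iterate j x] at this

theorem inv_bound (n : ℕ) (C : ℝ) : ∃ C' > 0, ∀ A B : En n →L[ℂ] En n, ‖A‖ ≤ C → A.det = 1 →
    B.comp A = ContinuousLinearMap.id ℂ _ → A.comp B = ContinuousLinearMap.id ℂ _ → ‖B‖ ≤ C' := by
  have hprop : ProperSpace (En n →L[ℂ] En n) := FiniteDimensional.proper ℂ _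
  let S : Set (En n →L[ℂ] En n) := closedBall 0 C ∩ {A | A.det = 1}
  have hS : IsCompact S := (isCompact_closedBall _ _).inter_right
    (isClosed_eq ContinuousLinearMap.continuous_det continuous_const)
  have hunit : ∀ A ∈ S, IsUnit A := by
    intro A hA
    have h1 : (A : En n →ₗ[ℂ] En n).det = 1 := hA.2
    have h2 : IsUnit (A : En n →ₗ[ℂ] En n).det := by rw [h1]; exact isUnit_one
    let e := LinearMap.equivOfIsUnitDet h2
    let e' := e.toContinuousLinearEquiv
    have he : ∀ x, e' x = A x := fun x => by simp [e', e]
    refine ⟨⟨A, e'.symm, ?_, ?_⟩, rfl⟩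
    · ext1 x
      change A (e'.symm x) = x
      rw [← he, e'.apply_symm_apply]
    · ext1 x
      change e'.symm (A x) = x
      rw [← he, e'.symm_apply_apply]
  have hc : ContinuousOn Ring.inverse S := by
    intro A hA
    obtain ⟨u, hu⟩ := hunit A hA
    rw [← hu]
    exact (NormedRing.inverse_continuousAt u).continuousWithinAt
  obtain ⟨C', hC'⟩ := hS.exists_bound_of_continuousOn hc
  refine ⟨max C' 1, by positivity, fun A B hA hd hBA hAB => ?_⟩
  have h1 := hC' A ⟨by simpa using hA, hd⟩
  let u : (En n →L[ℂ] En n)ˣ := ⟨A, B, hAB, hBA⟩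
  have h2 : Ring.inverse A = B := Ring.inverse_unit u
  rw [h2] at h1
  exact h1.trans (le_max_left _ _)

theorem shear_deriv {n : ℕ} {f g : En n → En n} (hf : Differentiable ℂ f) (hg : Differentiable ℂ g)
    (hgf : LeftInverse g f) (hfg : RightInverse g f)
    (l : En n →L[ℂ] ℂ) (v : En n) {h : ℂ → ℂ} (hh : Differentiable ℂ h) (x : En n) (N : ℕ) :
    Differentiable ℂ (fun t : ℂ => (f ∘ fun z => z + (t * h (l z)) • v)^[N] x) ∧
    HasDerivAt (fun t : ℂ => (f ∘ fun z => z + (t * h (l z)) • v)^[N] x)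
      (fderiv ℂ (f^[N]) x (SN f g (fun z => h (l z) • v) N x)) 0 := by
  induction N with
  | zero => 
    simp only [iterate_zero, id, SN, Finset.range_zero, Finset.sum_empty, map_zero]
    exact ⟨differentiable_const _, hasDerivAt_const _ _⟩
  | succ N ih =>
    obtain ⟨ih1, ih2⟩ := ih
    simp only [iterate_succ_apply']
    set F : ℂ → En n := fun t => (f ∘ fun z => z + (t * h (l z)) • v)^[N] x with hF
    have hF0 : F 0 = f^[N] x := by
      have : (f ∘ fun z => z + ((0:ℂ) * h (l z)) • v) = f := by ext1 z; simp
      simp only [hF, this]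
    change Differentiable ℂ (fun t => f (F t + (t * h (l (F t))) • v)) ∧ 
      HasDerivAt (fun t => f (F t + (t * h (l (F t))) • v)) _ 0
    have hlF : Differentiable ℂ fun t => h (l (F t)) := hh.comp (l.differentiable.comp ih1)
    refine ⟨hf.comp (ih1.add ((differentiable_id.mul hlF).smul_const v)), ?_⟩
    have h1 : HasDerivAt (fun t : ℂ => t * h (l (F t))) (h (l (F 0))) 0 := by
      have := (hasDerivAt_id (0:ℂ)).mul (hlF 0).hasDerivAt
      refine HasDerivAt.congr_deriv this ?_
      simp
    have h2 := ih2.add (h1.smul_const v)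
    have h3 : HasFDerivAt f (fderiv ℂ f (f^[N] x)) (F 0 + (0 * h (l (F 0))) • v) := by
      simpa [hF0] using (hf (f^[N] x)).hasFDerivAt
    have h4 := h3.comp_hasDerivAt (0:ℂ) h2
    refine h4.congr_deriv ?_
    have h5 : f^[N+1] = f ∘ f^[N] := iterate_succ' f N
    have h6 : SN f g (fun z => h (l z) • v) (N+1) x = SN f g (fun z => h (l z) • v) N x
      + fderiv ℂ (g^[N]) (f^[N] x) (h (l (f^[N] x)) • v) := by
      simp only [SN, Finset.sum_range_succ]
    rw [h6, h5, fderiv_comp x (hf _) ((hf.iterate N) _), ContinuousLinearMap.comp_apply, map_add (fderiv ℂ f^[N] x), hF0]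
    have h7 := congrArg (fun A : En n →L[ℂ] En n => A (h (l (f^[N] x)) • v)) (DI_eq hf hg hgf hfg N x)
    simp only [ContinuousLinearMap.comp_apply, ContinuousLinearMap.id_apply] at h7
    rw [h7]

structure Esc {n : ℕ} (f g : En n → En n) (q : En n) (r R R2 ε : ℝ) : Prop where
  hf : VAut f
  hg : VAut g
  hgf : LeftInverse g f
  hfg : RightInverse g f
  hr : 0 < r
  hε : 0 < ε
  H : ∀ G, VAut G → Near f R ε G → ∀ x ∈ ball q r, ∀ N : ℕ, ‖G^[N] x‖ ≤ R2

theorem Esc.bd {n : ℕ} {f g : En n → En n} {q : En n} {r R R2 ε : ℝ} (h : Esc f g q r R R2 ε)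
    (x : En n) (hx : x ∈ ball q r) (j : ℕ) : ‖f^[j] x‖ ≤ R2 :=
  h.H f h.hf (fun z _ => by simpa using h.hε) x hx j

theorem Esc.R2nn {n : ℕ} {f g : En n → En n} {q : En n} {r R R2 ε : ℝ} (h : Esc f g q r R R2 ε) :
    0 ≤ R2 := (norm_nonneg _).trans (h.bd q (mem_ball_self h.hr) 0)

theorem Esc.bounds {n : ℕ} {f g : En n → En n} {q : En n} {r R R2 ε : ℝ} (h : Esc f g q r R R2 ε) :
    ∃ C ≥ 1, ∀ x ∈ ball q (r/2), ∀ j : ℕ, ‖fderiv ℂ (f^[j]) x‖ ≤ C ∧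
      ‖fderiv ℂ (g^[j]) (f^[j] x)‖ ≤ C := by
  obtain ⟨C', hC'0, hC'⟩ := inv_bound n (2 * R2 / (r/2))
  have h1 : ∀ x ∈ ball q (r/2), ∀ j : ℕ, ‖fderiv ℂ (f^[j]) x‖ ≤ 2 * R2 / (r/2) := by
    intro x hx j
    refine cau1 (h.hf.diff.iterate j) (half_pos h.hr) fun z hz => h.bd z ?_ j
    rw [mem_ball] at *; linarith [dist_triangle z x q]
  refine ⟨max (max C' (2 * R2 / (r/2))) 1, le_max_right _ _, fun x hx j => ⟨?_, ?_⟩⟩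
  · exact (h1 x hx j).trans ((le_max_right _ _).trans (le_max_left _ _))
  · refine (hC' (fderiv ℂ (f^[j]) x) _ (h1 x hx j) ((h.hf.iterate j).2 x) 
      (ID_eq h.hf.diff h.hg.diff h.hgf j x) (DI_eq h.hf.diff h.hg.diff h.hgf h.hfg j x)).trans ?_
    exact ((le_max_left _ _).trans (le_max_left _ _))

theorem Esc.shear_bdd {n : ℕ} {f g : En n → En n} {q : En n} {r R R2 ε : ℝ} (H : Esc f g q r R R2 ε)
    (l : En n →L[ℂ] ℂ) (v : En n) (hlv : l v = 0) {h : ℂ → ℂ} (hh : Differentiable ℂ h) :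
    ∃ C, ∀ N : ℕ, ∀ x ∈ ball q (r/2), ‖SN f g (fun z => h (l z) • v) N x‖ ≤ C := by
  obtain ⟨C, hC1, hC⟩ := H.bounds
  have hnear : Near f R ε f := fun z _ => by simpa using H.hε
  obtain ⟨η, hη, hηp⟩ := hnear.perturb H.hf.diff.continuous H.hf.diff.continuous
  have hXc : Continuous fun z => h (l z) • v := 
    (hh.continuous.comp l.continuous).smul continuous_const
  obtain ⟨M, hM0, hM⟩ := bdd_ball hXc 0 R
  have ht : 0 < η / (2 * M) := by positivity
  refine ⟨C * (R2 / (η / (2 * M))), fun N x hx => ?_⟩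
  obtain ⟨hd, hda⟩ := shear_deriv H.hf.diff H.hg.diff H.hgf H.hfg l v hh x N
  have h1 := Complex.norm_deriv_le_of_forall_mem_sphere_norm_le (c := 0) (C := R2) ht hd.diffContOnCl (by
    intro t ht'
    have hVA : VAut (f ∘ fun z => z + (t * h (l z)) • v) :=
      H.hf.comp (shear_VAut l v hlv (h := fun ζ => t * h ζ) (hh.const_mul t))
    refine H.H _ hVA (hηp _ ?_) x (ball_subset_ball (by linarith [H.hr]) hx) N
    intro z hz
    rw [dist_eq_norm, add_sub_cancel_left, mul_smul, norm_smul]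
    have h3 : ‖t‖ = η / (2 * M) := by simpa using ht'
    rw [h3]
    calc _ ≤ η / (2 * M) * M := by gcongr; exact hM z hz
      _ = η / 2 := by field_simp
      _ < η := by linarith)
  rw [hda.deriv] at h1
  have h2 := congrArg (fun A : En n →L[ℂ] En n => A (SN f g (fun z => h (l z) • v) N x)) 
    (ID_eq H.hf.diff H.hg.diff H.hgf N x)
  simp only [ContinuousLinearMap.comp_apply, ContinuousLinearMap.id_apply] at h2
  rw [← h2]
  refine (ContinuousLinearMap.le_opNorm _ _).trans ?_
  have := (hC x hx N).2
  gcongr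

def Subl {n : ℕ} (f g : En n → En n) (q : En n) (r : ℝ) (X : En n → En n) : Prop :=
  ∀ δ > 0, ∃ C, ∀ N : ℕ, ∀ x ∈ ball q (r/2), ‖SN f g X N x‖ ≤ C + N * δ

theorem SN_add {n : ℕ} (f g : En n → En n) (X Y : En n → En n) (N : ℕ) (x : En n) :
    SN f g (fun z => X z + Y z) N x = SN f g X N x + SN f g Y N x := by
  simp [SN, Finset.sum_add_distrib]

theorem SN_smul {n : ℕ} (f g : En n → En n) (X : En n → En n) (c : ℂ) (N : ℕ) (x : En n) :
    SN f g (fun z => c • X z) N x = c • SN f g X N x := by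
  simp [SN, Finset.smul_sum]

theorem Subl.sum {n : ℕ} {f g : En n → En n} {q : En n} {r : ℝ} {ι : Type*} (s : Finset ι)
    (X : ι → En n → En n) (h : ∀ i ∈ s, Subl f g q r (X i)) : Subl f g q r (fun z => ∑ i ∈ s, X i z) := by
  classical
  induction s using Finset.induction_on with
  | empty => intro δ hδ; exact ⟨0, fun N x hx => by simp [SN]; positivity⟩
  | insert a s ha ih =>
    intro δ hδ
    obtain ⟨C1, h1⟩ := ih (fun i hi => h i (Finset.mem_insert_of_mem hi)) (δ/2) (half_pos hδ)
    obtain ⟨C2, h2⟩ := h a (Finset.mem_insert_self _ _) (δ/2) (half_pos hδ)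
    refine ⟨C2 + C1, fun N x hx => ?_⟩
    simp only [Finset.sum_insert ha]
    rw [SN_add]
    refine (norm_add_le _ _).trans ?_
    linarith [h1 N x hx, h2 N x hx]

noncomputable def Vab {n : ℕ} (a b : Fin n) (H : En n → ℂ) (z : En n) : En n :=
  fderiv ℂ H z (EuclideanSpace.single b 1) • EuclideanSpace.single a (1:ℂ)
   - fderiv ℂ H z (EuclideanSpace.single a 1) • EuclideanSpace.single b (1:ℂ)

theorem Esc.span_bdd {n : ℕ} {f g : En n → En n} {q : En n} {r R R2 ε : ℝ} (H : Esc f g q r R R2 ε)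
    (a b : Fin n) (P : En n → ℂ) 
    (hP : P ∈ Submodule.span ℂ (range fun (l : En n →L[ℂ] ℂ) => fun z : En n => Complex.exp (l z))) :
    Differentiable ℂ P ∧ ∃ C, ∀ N : ℕ, ∀ x ∈ ball q (r/2), ‖SN f g (Vab a b P) N x‖ ≤ C := by
  induction hP using Submodule.span_induction with
  | mem P hP =>
    obtain ⟨l, rfl⟩ := hP
    refine ⟨Complex.differentiable_exp.comp l.differentiable, ?_⟩
    have e : Vab a b (fun z => Complex.exp (l z)) = fun z => Complex.exp (l z) • 
      (l (EuclideanSpace.single b 1) • EuclideanSpace.single a (1:ℂ)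
        - l (EuclideanSpace.single a 1) • EuclideanSpace.single b (1:ℂ)) := by
      funext z
      have h1 : HasFDerivAt (fun z => Complex.exp (l z)) (Complex.exp (l z) • l) z :=
        (Complex.hasDerivAt_exp (l z)).comp_hasFDerivAt z l.hasFDerivAt
      rw [Vab, h1.fderiv, smul_sub, smul_smul, smul_smul]
      simp
    rw [e]
    apply H.shear_bdd l _ _ Complex.differentiable_exp
    simp [mul_comm]
  | zero =>
    refine ⟨differentiable_const _, 0, fun N x hx => ?_⟩
    have : Vab a b (0 : En n → ℂ) = fun _ => 0 := by
      funext z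
      have : fderiv ℂ (0 : En n → ℂ) z = 0 := by simp
      simp [Vab, this]
    rw [this]; simp [SN]
  | add P Q _ _ hP hQ =>
    obtain ⟨hP1, C1, hP2⟩ := hP
    obtain ⟨hQ1, C2, hQ2⟩ := hQ
    refine ⟨hP1.add hQ1, C1 + C2, fun N x hx => ?_⟩
    have : Vab a b (P + Q) = fun z => Vab a b P z + Vab a b Q z := by
      funext z
      rw [Vab, fderiv_add (hP1 z) (hQ1 z)]
      simp only [Vab, ContinuousLinearMap.add_apply, add_smul]; abel
    rw [this, SN_add]
    exact (norm_add_le _ _).trans (add_le_add (hP2 N x hx) (hQ2 N x hx))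
  | smul c P _ hP =>
    obtain ⟨hP1, C1, hP2⟩ := hP
    refine ⟨hP1.const_smul c, ‖c‖ * C1, fun N x hx => ?_⟩
    have : Vab a b (c • P) = fun z => c • Vab a b P z := by
      funext z
      rw [Vab, fderiv_const_smul (hP1 z)]
      simp only [Vab, ContinuousLinearMap.smul_apply, smul_sub, smul_smul, smul_eq_mul]
    rw [this, SN_smul, norm_smul]
    exact mul_le_mul_of_nonneg_left (hP2 N x hx) (norm_nonneg _)

theorem Esc.subl_Vab {n : ℕ} {f g : En n → En n} {q : En n} {r R R2 ε : ℝ} (H : Esc f g q r R R2 ε)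
    (a b : Fin n) (u : En n → ℂ) (hu : Differentiable ℂ u) : Subl f g q r (Vab a b u) := by
  intro δ hδ
  obtain ⟨C, hC1, hC⟩ := H.bounds
  have hC0 : 0 < C := by linarith
  obtain ⟨P, hP, hPu⟩ := exp_approx u hu (R2 + 1) (δ / (4 * C)) (by positivity)
  obtain ⟨hPd, C1, hC1⟩ := H.span_bdd a b P hP
  refine ⟨C1, fun N x hx => ?_⟩
  have hd : ∀ y ∈ closedBall (0 : En n) R2, ‖fderiv ℂ u y - fderiv ℂ P y‖ ≤ δ / (2 * C) := by
    intro y hy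
    rw [← fderiv_sub (hu y) (hPd y)]
    refine (cau1 (hu.sub hPd) one_pos (C := δ / (4 * C)) ?_).trans (le_of_eq ?_)
    · intro z hz
      refine (hPu z ?_).le
      rw [mem_closedBall] at *; rw [mem_ball] at hz
      linarith [dist_triangle z y 0]
    · field_simp; ring
  have hV : ∀ y ∈ closedBall (0 : En n) R2, ‖Vab a b u y - Vab a b P y‖ ≤ δ / C := by
    intro y hy
    have e : Vab a b u y - Vab a b P y = (fderiv ℂ u y - fderiv ℂ P y) (EuclideanSpace.single b 1) • EuclideanSpace.single a (1:ℂ)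
      - (fderiv ℂ u y - fderiv ℂ P y) (EuclideanSpace.single a 1) • EuclideanSpace.single b (1:ℂ) := by
      simp only [Vab, ContinuousLinearMap.sub_apply, sub_smul]; abel
    have h1 : ∀ c : Fin n, ‖(fderiv ℂ u y - fderiv ℂ P y) (EuclideanSpace.single c 1)‖ ≤ δ / (2 * C) := by
      intro c
      refine (ContinuousLinearMap.le_opNorm _ _).trans ?_
      simpa using hd y hy
    rw [e]
    refine (norm_sub_le _ _).trans ?_
    rw [norm_smul, norm_smul]
    have ha := h1 a
    have hb := h1 b
    have : δ / C = δ / (2 * C) + δ / (2 * C) := by field_simp; ring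
    simp only [EuclideanSpace.norm_single, norm_one, mul_one]
    linarith
  have e2 : SN f g (Vab a b u) N x = SN f g (Vab a b P) N x + SN f g (fun z => Vab a b u z - Vab a b P z) N x := by
    rw [← SN_add]; congr 1; funext z; abel
  rw [e2]
  refine (norm_add_le _ _).trans (add_le_add (hC1 N x hx) ?_)
  refine (norm_sum_le _ _).trans ?_
  have : ∀ j ∈ Finset.range N, ‖fderiv ℂ (g^[j]) (f^[j] x) (Vab a b u (f^[j] x) - Vab a b P (f^[j] x))‖ ≤ δ := by
    intro j _
    refine (ContinuousLinearMap.le_opNorm _ _).trans ?_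
    have h1 := (hC x hx j).2
    have h2 := hV (f^[j] x) (by simpa using H.bd x (ball_subset_ball (by linarith [H.hr]) hx) j)
    calc _ ≤ C * (δ / C) := by gcongr
      _ = δ := by field_simp
  refine (Finset.sum_le_sum this).trans (le_of_eq ?_)
  simp

/-- the divergence free field `(1-n) h + tr(Dh) z - Dh z` -/
noncomputable def trE {n : ℕ} (A : En n →L[ℂ] En n) : ℂ := ∑ b, (A (EuclideanSpace.single b 1)) b

noncomputable def Xst {n : ℕ} (h : En n → En n) (z : En n) : En n :=
  (1 - (n:ℂ)) • h z + trE (fderiv ℂ h z) • z - fderiv ℂ h z z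

theorem Esc.subl_Xst {n : ℕ} {f g : En n → En n} {q : En n} {r R R2 ε : ℝ} (H : Esc f g q r R R2 ε)
    (h : En n → En n) (hh : Differentiable ℂ h) : Subl f g q r (Xst h) := by
  have hco : ∀ a, Differentiable ℂ fun z : En n => z a := fun a => (EuclideanSpace.proj (𝕜 := ℂ) a).differentiable
  have hd : ∀ a b : Fin n, Differentiable ℂ fun z : En n => z a * h z b := fun a b =>
    (hco a).mul ((hco b).comp hh)
  have e : Xst h = fun z => ∑ a, ∑ b, Vab a b (fun z : En n => z a * h z b) z := by
    funext z
    have hD : ∀ a b : Fin n, ∀ w, fderiv ℂ (fun z : En n => z a * h z b) z w = w a * h z b + z a * (fderiv ℂ h z w) b := by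
      intro a b w
      have h1 : HasFDerivAt (fun z : En n => z a) (EuclideanSpace.proj (𝕜 := ℂ) a) z := (EuclideanSpace.proj (𝕜 := ℂ) a).hasFDerivAt
      have h2 : HasFDerivAt (fun z : En n => h z b) ((EuclideanSpace.proj (𝕜 := ℂ) b).comp (fderiv ℂ h z)) z :=
        (EuclideanSpace.proj (𝕜 := ℂ) b).hasFDerivAt.comp z (hh z).hasFDerivAt
      have h3 : HasFDerivAt (fun z : En n => z a * h z b) _ z := h1.mul h2
      rw [h3.fderiv]
      simp; ring
    have hA : fderiv ℂ h z z = ∑ a, z a • fderiv ℂ h z (EuclideanSpace.single a 1) := clm_sum _ z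
    ext c
    simp only [Vab, hD, Xst, hA, trE]
    simp [Finset.sum_add_distrib, Finset.sum_sub_distrib, sub_mul, add_mul, Finset.sum_mul, Pi.single_apply, mul_comm]
    rw [Finset.mul_sum]
    ring
  rw [e]
  exact Subl.sum _ _ fun a _ => Subl.sum _ _ fun b _ => H.subl_Vab a b _ (hd a b)

theorem det_expand {n : ℕ} (A : En n →L[ℂ] En n) : ∃ p : Polynomial ℂ, ∀ t : ℂ,
    (ContinuousLinearMap.id ℂ (En n) + t • A).det = 1 + trE A * t + p.eval t * t^2 := by
  let b := (EuclideanSpace.basisFun (Fin n) ℂ).toBasis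
  let M := LinearMap.toMatrix b b (A : En n →ₗ[ℂ] En n)
  refine ⟨(Matrix.det (1 + (Polynomial.X : Polynomial ℂ) • M.map Polynomial.C)).divX.divX, fun t => ?_⟩
  have h := Matrix.det_one_add_smul t M
  have h1 : (ContinuousLinearMap.id ℂ (En n) + t • A).det = (1 + t • M).det := by
    change LinearMap.det (LinearMap.id + t • (A : En n →ₗ[ℂ] En n)) = _
    rw [← LinearMap.det_toMatrix b, map_add, LinearMap.toMatrix_id, map_smul]
  have h2 : M.trace = trE A := by
    simp [Matrix.trace, trE, M, LinearMap.toMatrix_apply, b]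
  rw [h1, h, h2]

theorem trace_est (n : ℕ) (L : ℝ) (hL : 0 ≤ L) : ∃ C ≥ 0, ∀ A : En n →L[ℂ] En n, ‖A‖ ≤ L →
    (ContinuousLinearMap.id ℂ (En n) + A).det = 1 → ‖trE A‖ ≤ C * ‖A‖^2 := by
  have hprop : ProperSpace (En n →L[ℂ] En n) := FiniteDimensional.proper ℂ _
  have hc : Continuous fun A : En n →L[ℂ] En n => (ContinuousLinearMap.id ℂ (En n) + A).det - 1 - trE A := by
    refine ((ContinuousLinearMap.continuous_det.comp (continuous_const.add continuous_id)).sub continuous_const).sub ?_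
    unfold trE
    refine continuous_finset_sum _ fun b _ => ?_
    exact (EuclideanSpace.proj (𝕜 := ℂ) b).continuous.comp (ContinuousLinearMap.apply ℂ (En n) (EuclideanSpace.single b (1:ℂ))).continuous
  obtain ⟨K, hK⟩ := (isCompact_closedBall (0 : En n →L[ℂ] En n) (L+1)).exists_bound_of_continuousOn hc.continuousOn
  have hK0 : 0 ≤ K := (norm_nonneg _).trans (hK 0 (by simp; linarith))
  refine ⟨(K+1) , by positivity, fun A hA hdet => ?_⟩
  rcases eq_or_ne A 0 with rfl | hA0
  · simp [trE]
  have hAp : 0 < ‖A‖ := norm_pos_iff.mpr hA0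
  obtain ⟨p, hp⟩ := det_expand A
  let φ : ℂ → ℂ := fun t => p.eval t * t^2
  have hφ : ∀ t, φ t = (ContinuousLinearMap.id ℂ (En n) + t • A).det - 1 - trE A * t := by
    intro t; rw [hp]; simp only [φ]; ring
  have hφ0 : φ 0 = 0 := by simp [φ]
  have hR1 : 0 < (L+1)/‖A‖ := by positivity
  have hm : MapsTo φ (ball 0 ((L+1)/‖A‖)) (ball (φ 0) (K+1)) := by
    intro t ht
    rw [mem_ball_zero_iff, lt_div_iff₀ hAp] at ht
    rw [hφ0, mem_ball_zero_iff, hφ]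
    have := hK (t • A) (by rw [mem_closedBall_zero_iff, norm_smul]; exact ht.le)
    have e : trE (t • A) = trE A * t := by simp [trE, Finset.mul_sum, mul_comm]
    rw [e] at this
    linarith
  have hlo : (fun w => φ w - φ 0) =o[𝓝 0] (fun w => ‖w - 0‖ ^ 1) := by
    simp only [hφ0, sub_zero, pow_one]
    have h1 : (fun w : ℂ => p.eval w * w) =o[𝓝 0] (fun w => (1:ℂ)) := by
      rw [Asymptotics.isLittleO_one_iff]
      have : Continuous fun w : ℂ => p.eval w * w := by fun_prop
      simpa using this.tendsto 0
    have h2 := h1.mul_isBigO (Asymptotics.isBigO_refl (fun w : ℂ => w) (𝓝 0))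
    have h3 : φ =o[𝓝 0] (fun w : ℂ => w) := by
      refine h2.congr ?_ ?_
      · intro w; simp only [φ]; ring
      · intro w; ring
    exact h3.norm_right
  have hd : DifferentiableOn ℂ φ (ball 0 ((L+1)/‖A‖)) := by
    apply Differentiable.differentiableOn
    exact p.differentiable.mul (differentiable_pow 2)
  have h1m : (1:ℂ) ∈ ball (0:ℂ) ((L+1)/‖A‖) := by
    rw [mem_ball_zero_iff, lt_div_iff₀ hAp]; simp; linarith
  have := Complex.dist_le_mul_div_pow_of_mapsTo_ball_of_isLittleO (n := 1) hd (hm.mono_right ball_subset_closedBall) hlo h1m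
  rw [hφ0, dist_zero_right, hφ, one_smul, hdet] at this
  simp only [sub_self, zero_sub, norm_neg, mul_one, dist_zero_right, norm_one] at this
  refine this.trans ?_
  gcongr
  rw [one_div, inv_div]
  exact div_le_self (norm_nonneg _) (by linarith)

theorem opl {n : ℕ} {A : En n →L[ℂ] En n} {v : En n} {a b : ℝ} (hA : ‖A‖ ≤ a) (hv : ‖v‖ ≤ b) :
    ‖A v‖ ≤ a * b := 
  (A.le_opNorm v).trans (mul_le_mul hA hv (norm_nonneg _) ((norm_nonneg _).trans hA))

theorem trE_one (n : ℕ) : trE (ContinuousLinearMap.id ℂ (En n)) = n := by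
  simp [trE]

theorem trE_add {n : ℕ} (A B : En n →L[ℂ] En n) : trE (A + B) = trE A + trE B := by
  simp [trE, Finset.sum_add_distrib]

/-- the algebraic core -/
theorem quad_core {n : ℕ} {C CL R2 C3 e : ℝ} (hC : 1 ≤ C) (hCL : 0 ≤ CL) (hR2 : 0 ≤ R2) (hC3 : 0 ≤ C3) 
    (htr : ∀ A : En n →L[ℂ] En n, ‖A‖ ≤ C^2*(CL+1) →
      (ContinuousLinearMap.id ℂ (En n) + A).det = 1 → ‖trE A‖ ≤ C3 * ‖A‖^2)
    (he0 : 0 ≤ e) (he1 : e ≤ 1)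
    (a a' ζ : En n) (P P' Q Q' T Dh : En n →L[ℂ] En n) 
    (hP : ‖P‖ ≤ C) (hQ : ‖Q‖ ≤ C) (hP' : ‖P'‖ ≤ C) (hQ' : ‖Q'‖ ≤ C) (hT : ‖T‖ ≤ C)
    (ha : ‖a‖ ≤ R2) (ha' : ‖a'‖ ≤ R2) (hζ : ‖ζ‖ ≤ e) (hT1 : ‖T - ContinuousLinearMap.id ℂ (En n)‖ ≤ e)
    (hQP : ∀ v, Q (P v) = v) (hPQ : ∀ v, P (Q v) = v) (hPQ' : ∀ v, P' (Q' v) = v) (hQP' : ∀ v, Q' (P' v) = v)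
    (hDh : ∀ v, Dh v = P' (T (Q v))) (hdet : Dh.det = 1)
    (hPP : ‖P' - P‖ ≤ CL * e) (hta : ‖a' - a - P ζ‖ ≤ CL * e^2) :
    ‖Q ((1 - (n:ℂ)) • a' + trE Dh • a - Dh a) + (n:ℂ) • ζ - (Q' a' - T (Q a))‖ ≤ 
      (n * (C * CL) + C3 * (C^2*(CL+1))^2 * (C * R2) + C * CL * (C * CL * C * R2 + 1 + C * CL + C * R2)) * e^2 := by
  have hC0 : 0 ≤ C := by linarith
  have key : Q ((1 - (n:ℂ)) • a' + trE Dh • a - Dh a) + (n:ℂ) • ζ - (Q' a' - T (Q a)) =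
      - ((n:ℂ) • Q (a' - a - P ζ)) + (trE Dh - n) • Q a + Q ((P' - P) (Q' a' - T (Q a))) := by
    simp only [hDh a, map_add, map_sub, map_smul, hQP, ContinuousLinearMap.sub_apply, hPQ', sub_smul, smul_sub, one_smul]
    abel
  have h1 : ‖Q (a' - a - P ζ)‖ ≤ C * (CL * e^2) := opl hQ hta
  have hV : ‖Q a‖ ≤ C * R2 := opl hQ ha
  have h2 : ‖Dh - ContinuousLinearMap.id ℂ (En n)‖ ≤ C^2*(CL+1) * e := by
    refine ContinuousLinearMap.opNorm_le_bound _ (by positivity) fun v => ?_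
    have : (Dh - ContinuousLinearMap.id ℂ (En n)) v = (P' - P) (T (Q v)) + P ((T - ContinuousLinearMap.id ℂ (En n)) (Q v)) := by
      simp only [ContinuousLinearMap.sub_apply, hDh, ContinuousLinearMap.id_apply, map_sub, hPQ]
      abel
    rw [this]
    have hq := opl hQ (le_refl ‖v‖)
    refine (norm_add_le _ _).trans ((add_le_add (opl hPP (opl hT hq)) (opl hP (opl hT1 hq))).trans (le_of_eq ?_))
    ring
  have h2' : ‖Dh - ContinuousLinearMap.id ℂ (En n)‖ ≤ C^2*(CL+1) := 
    h2.trans (mul_le_of_le_one_right (by positivity) he1)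
  have h3 : ‖trE Dh - n‖ ≤ C3 * (C^2*(CL+1) * e)^2 := by
    have e1 : trE Dh - n = trE (Dh - ContinuousLinearMap.id ℂ (En n)) := by
      have := trE_add (Dh - ContinuousLinearMap.id ℂ (En n)) (ContinuousLinearMap.id ℂ (En n))
      rw [sub_add_cancel, trE_one] at this
      rw [this]; ring
    rw [e1]
    refine (htr _ h2' (by rw [add_sub_cancel]; exact hdet)).trans ?_
    gcongr
  have h4 : ‖Q' a' - T (Q a)‖ ≤ (C * CL * C * R2 + 1 + C * CL + C * R2) * e := by
    have e1 : Q' a' - T (Q a) = - (Q' ((P' - P) (Q a'))) + ζ + Q (a' - a - P ζ) - (T - ContinuousLinearMap.id ℂ (En n)) (Q a) := by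
      simp only [ContinuousLinearMap.sub_apply, ContinuousLinearMap.id_apply, map_sub, hPQ, hQP, hQP']
      abel
    rw [e1]
    have b1 := opl hQ' (opl hPP (opl hQ ha'))
    have b2 := opl hT1 hV
    have b3 : C * (CL * e^2) ≤ C * CL * e := by
      have : e^2 ≤ e := by nlinarith
      have : C * CL * e^2 ≤ C * CL * e := by gcongr
      linarith
    have := norm_sub_le (- (Q' ((P' - P) (Q a'))) + ζ + Q (a' - a - P ζ)) ((T - ContinuousLinearMap.id ℂ (En n)) (Q a))
    have t2 := norm_add_le (- (Q' ((P' - P) (Q a'))) + ζ) (Q (a' - a - P ζ))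
    have t3 := norm_add_le (- (Q' ((P' - P) (Q a')))) ζ
    rw [norm_neg] at t3
    nlinarith
  rw [key]
  have b1 : ‖- ((n:ℂ) • Q (a' - a - P ζ))‖ ≤ n * (C * (CL * e^2)) := by
    rw [norm_neg, norm_smul, Complex.norm_natCast]; gcongr
  have b2 : ‖(trE Dh - n) • Q a‖ ≤ C3 * (C^2*(CL+1) * e)^2 * (C * R2) := by
    rw [norm_smul]; gcongr
  have b3 := opl hQ (opl hPP h4)
  refine (norm_add_le _ _).trans ((add_le_add ((norm_add_le _ _).trans (add_le_add b1 b2)) b3).trans (le_of_eq ?_))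
  ring

theorem tele {E : Type*} [NormedAddCommGroup E] (V : ℕ → E) (m N : ℕ) (B : ℝ) (hB : ∀ i, ‖V i‖ ≤ B) :
    ‖∑ j ∈ Finset.range N, (V (j+m) - V j)‖ ≤ 2 * m * B := by
  have : ∑ j ∈ Finset.range N, (V (j+m) - V j) = ∑ i ∈ Finset.range m, (V (N+i) - V i) := by
    rw [Finset.sum_sub_distrib, Finset.sum_sub_distrib, sub_eq_sub_iff_add_eq_add]
    have h1 := Finset.sum_range_add V N m
    have h2 := Finset.sum_range_add V m N
    rw [add_comm m N] at h2
    have h3 : ∑ x ∈ Finset.range N, V (x + m) = ∑ x ∈ Finset.range N, V (m + x) := by simp [add_comm]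
    rw [h3, add_comm, ← h2, h1, add_comm]
  rw [this]
  refine (norm_sum_le _ _).trans ?_
  calc _ ≤ ∑ i ∈ Finset.range m, (2*B) := Finset.sum_le_sum fun i _ => by
        linarith [norm_sub_le (V (N+i)) (V i), hB (N+i), hB i]
    _ = _ := by simp; ring

theorem Esc.quad {n : ℕ} {f g : En n → En n} {q : En n} {r R R2 ε : ℝ} (H : Esc f g q r R R2 ε) :
    ∃ C1 > 0, ∀ m : ℕ, ∀ x ∈ ball q (r/4), f^[m] x ∈ ball q (r/4) → ∀ e : ℝ, e ≤ 1 →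
      ‖f^[m] x - x‖ ≤ e → ‖fderiv ℂ (f^[m]) x - ContinuousLinearMap.id ℂ (En n)‖ ≤ e →
      n * ‖f^[m] x - x‖ ≤ C1 * e^2 := by
  obtain ⟨C, hC1, hC⟩ := H.bounds
  have hr := H.hr
  have hR2 := H.R2nn
  set CL := 32 * R2 / r^2 with hCLd
  have hCL : 0 ≤ CL := by positivity
  obtain ⟨C3, hC3, htr⟩ := trace_est n (C^2*(CL+1)) (by positivity)
  set K := (n * (C * CL) + C3 * (C^2*(CL+1))^2 * (C * R2) + C * CL * (C * CL * C * R2 + 1 + C * CL + C * R2)) with hK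
  have hK0 : 0 ≤ K := by positivity
  refine ⟨K + 1, by positivity, fun m x hx hx' e he1 hζ hT1 => ?_⟩
  have he0 : 0 ≤ e := (norm_nonneg _).trans hζ
  have hxh : x ∈ ball q (r/2) := ball_subset_ball (by linarith) hx
  have hxh' : f^[m] x ∈ ball q (r/2) := ball_subset_ball (by linarith) hx'
  set V : ℕ → En n := fun j => fderiv ℂ (g^[j]) (f^[j] x) (f^[j] x) with hVd
  set T := fderiv ℂ (f^[m]) x with hTd
  set ζ := f^[m] x - x with hζd
  have hT : ‖T‖ ≤ C := (hC x hxh m).1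
  have hb : ∀ y ∈ ball q (r/2), ∀ j, ‖f^[j] y‖ ≤ R2 := fun y hy j => H.bd y (ball_subset_ball (by linarith) hy) j
  have hVb : ∀ j, ‖V j‖ ≤ C * R2 := fun j => opl (hC x hxh j).2 (hb x hxh j)
  have hdi := H.hf.diff
  have hgi := H.hg.diff
  have hj : ∀ j, ‖fderiv ℂ (g^[j]) (f^[j] x) (Xst (f^[m]) (f^[j] x)) + (n:ℂ) • ζ - T (V (j+m) - V j)‖ ≤ K * e^2 := by
    intro j
    have hcomm : f^[m] (f^[j] x) = f^[j] (f^[m] x) := by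
      rw [← iterate_add_apply, ← iterate_add_apply, add_comm]
    have ap : ∀ {A B : En n →L[ℂ] En n}, A.comp B = ContinuousLinearMap.id ℂ (En n) → ∀ v, A (B v) = v := by
      intro A B h v
      have := congrArg (fun L : En n →L[ℂ] En n => L v) h
      simpa using this
    have hTV : T (V (j+m)) = fderiv ℂ (g^[j]) (f^[j] (f^[m] x)) (f^[j] (f^[m] x)) := by
      have e1 : g^[j+m] = g^[m] ∘ g^[j] := by rw [add_comm, iterate_add]
      simp only [hVd]
      rw [iterate_add_apply f j m x, e1, fderiv_comp _ (hgi.iterate m _) (hgi.iterate j _), (H.hgf.iterate j)]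
      exact ap (DI_eq hdi hgi H.hgf H.hfg m x) _
    have hDh : fderiv ℂ (f^[m]) (f^[j] x) = ((fderiv ℂ (f^[j]) (f^[m] x)).comp T).comp (fderiv ℂ (g^[j]) (f^[j] x)) := by
      have e1 : f^[m] ∘ f^[j] = f^[j] ∘ f^[m] := by rw [← iterate_add, ← iterate_add, add_comm]
      have e2 := congrArg (fun F => fderiv ℂ F x) e1
      rw [fderiv_comp _ (hdi.iterate m _) (hdi.iterate j _), fderiv_comp _ (hdi.iterate j _) (hdi.iterate m _)] at e2
      rw [hTd, ← e2, ContinuousLinearMap.comp_assoc, DI_eq hdi hgi H.hgf H.hfg j x]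
      rfl
    have hbq : ∀ z ∈ ball q r, ‖f^[j] z‖ ≤ R2 := fun z hz => H.bd z hz j
    have c2 := cau2 (hdi.iterate j) hr hbq hx hx'
    have c3 := cau3 (hdi.iterate j) hr hbq hx hx'
    have := quad_core hC1 hCL hR2 hC3 htr he0 he1 (f^[j] x) (f^[j] (f^[m] x)) ζ
      (fderiv ℂ (f^[j]) x) (fderiv ℂ (f^[j]) (f^[m] x)) (fderiv ℂ (g^[j]) (f^[j] x)) 
      (fderiv ℂ (g^[j]) (f^[j] (f^[m] x))) T (fderiv ℂ (f^[m]) (f^[j] x)) (hC x hxh j).1 (hC x hxh j).2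
      (hC _ hxh' j).1 (hC _ hxh' j).2 hT (hb x hxh j) (hb _ hxh' j) hζ hT1
      (ap (ID_eq hdi hgi H.hgf j x)) (ap (DI_eq hdi hgi H.hgf H.hfg j x)) 
      (ap (DI_eq hdi hgi H.hgf H.hfg j _)) (ap (ID_eq hdi hgi H.hgf j _)) 
      (fun v => by rw [hDh]; rfl) ((H.hf.iterate m).2 _) 
      (c2.trans (by gcongr)) (c3.trans (by gcongr))
    rw [map_sub, hTV, Xst, hcomm]
    exact this
  have hsub : ∀ δ > 0, n * ‖ζ‖ ≤ δ + K * e^2 := by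
    intro δ hδ
    obtain ⟨C', hC'⟩ := H.subl_Xst (f^[m]) (hdi.iterate m) (δ/2) (half_pos hδ)
    set B := C' + C * (2 * m * (C * R2)) with hB
    have hN : ∀ N : ℕ, N * (n * ‖ζ‖) ≤ B + N * (δ/2) + N * (K * e^2) := by
      intro N
      have e1 : (N:ℂ) • ((n:ℂ) • ζ) = ∑ j ∈ Finset.range N, (fderiv ℂ (g^[j]) (f^[j] x) (Xst (f^[m]) (f^[j] x)) + (n:ℂ) • ζ - T (V (j+m) - V j))
        - SN f g (Xst (f^[m])) N x + T (∑ j ∈ Finset.range N, (V (j+m) - V j)) := by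
        rw [map_sum, Finset.sum_sub_distrib, Finset.sum_add_distrib, SN]
        simp only [Finset.sum_const, Finset.card_range]
        rw [← Nat.cast_smul_eq_nsmul ℂ]
        abel
      have e2 : ‖(N:ℂ) • ((n:ℂ) • ζ)‖ = N * (n * ‖ζ‖) := by simp [norm_smul]
      rw [← e2, e1]
      have b1 : ‖∑ j ∈ Finset.range N, (fderiv ℂ (g^[j]) (f^[j] x) (Xst (f^[m]) (f^[j] x)) + (n:ℂ) • ζ - T (V (j+m) - V j))‖ ≤ N * (K * e^2) := by
        refine (norm_sum_le _ _).trans ((Finset.sum_le_sum fun j _ => hj j).trans (le_of_eq ?_))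
        simp
      have b2 := opl hT (tele V m N _ hVb)
      have b3 := hC' N x hxh
      refine (norm_add_le _ _).trans ((add_le_add ((norm_sub_le _ _).trans (add_le_add b1 b3)) b2).trans (le_of_eq ?_))
      rw [hB]; ring
    by_contra hcon
    push Not at hcon
    obtain ⟨N, hNb⟩ := exists_nat_gt (B / (δ/2))
    rw [div_lt_iff₀ (half_pos hδ)] at hNb
    have := hN N
    have hNn : (0:ℝ) ≤ N := Nat.cast_nonneg N
    nlinarith
  have : n * ‖ζ‖ ≤ K * e^2 := le_of_forall_pos_le_add fun δ hδ => by linarith [hsub δ hδ]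
  nlinarith [sq_nonneg e]

theorem Esc.pigeon {n : ℕ} {f g : En n → En n} {q : En n} {r R R2 ε : ℝ} (H : Esc f g q r R R2 ε)
    (τ : ℝ) (hτ : 0 < τ) : ∃ i j : ℕ, i < j ∧ ∀ x ∈ ball q (r/4), ‖f^[j] x - f^[i] x‖ ≤ τ := by
  obtain ⟨C, hC1, hC⟩ := H.bounds
  have hr := H.hr
  have hC0 : 0 < C := by linarith
  have hLip : ∀ j, ∀ x ∈ ball q (r/2), ∀ y ∈ ball q (r/2), ‖f^[j] y - f^[j] x‖ ≤ C * ‖y - x‖ := by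
    intro j x hx y hy
    exact (convex_ball q (r/2)).norm_image_sub_le_of_norm_fderiv_le (fun z _ => H.hf.diff.iterate j z)
      (fun z hz => (hC z hz j).1) hx hy
  obtain ⟨t, hts, htf, htc⟩ := (isCompact_closedBall q (r/4)).finite_cover_balls (e := τ / (3 * C)) (by positivity)
  have : Fintype t := htf.fintype
  let u : ℕ → (t → En n) := fun j k => f^[j] k.1
  have hsub : closedBall q (r/4) ⊆ ball q (r/2) := closedBall_subset_ball (by linarith)
  have hu : ∀ j, u j ∈ closedBall (0 : t → En n) R2 := by
    intro j
    rw [mem_closedBall_zero_iff, pi_norm_le_iff_of_nonneg H.R2nn]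
    exact fun k => H.bd k.1 (ball_subset_ball (by linarith) (hsub (hts k.2))) j
  obtain ⟨a, -, φ, hφ, hφa⟩ := (isCompact_closedBall (0 : t → En n) R2).tendsto_subseq hu
  have hcau := hφa.cauchySeq
  rw [Metric.cauchySeq_iff'] at hcau
  obtain ⟨N, hN⟩ := hcau (τ/3) (by positivity)
  refine ⟨φ N, φ (N+1), hφ (Nat.lt_succ_self N), fun x hx => ?_⟩
  have h1 := hN (N+1) (Nat.le_succ N)
  obtain ⟨y, hy, hxy⟩ : ∃ y ∈ t, dist x y < τ / (3 * C) := by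
    have := htc (ball_subset_closedBall hx)
    simpa using this
  have hxh := hsub (ball_subset_closedBall hx)
  have hyh := hsub (hts hy)
  have h2 := (dist_le_pi_dist _ _ (⟨y, hy⟩ : t)).trans_lt h1
  simp only [comp, u, dist_eq_norm] at h2
  have h3 : ∀ j, ‖f^[j] x - f^[j] y‖ ≤ τ/3 := by
    intro j
    refine (hLip j y hyh x hxh).trans ?_
    rw [← dist_eq_norm]
    calc _ ≤ C * (τ / (3 * C)) := by gcongr
      _ = _ := by field_simp
  have e : f^[φ (N+1)] x - f^[φ N] x = (f^[φ (N+1)] x - f^[φ (N+1)] y) + (f^[φ (N+1)] y - f^[φ N] y) - (f^[φ N] x - f^[φ N] y) := by abel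
  rw [e]
  refine (norm_sub_le _ _).trans ?_
  have := norm_add_le (f^[φ (N+1)] x - f^[φ (N+1)] y) (f^[φ (N+1)] y - f^[φ N] y)
  have h31 := h3 (φ (N+1))
  have h32 := h3 (φ N)
  linarith

theorem Esc.recur {n : ℕ} {f g : En n → En n} {q : En n} {r R R2 ε : ℝ} (H : Esc f g q r R R2 ε)
    (η : ℝ) (hη : 0 < η) : ∃ m : ℕ, 1 ≤ m ∧ ∀ x ∈ ball q (r/8), ‖f^[m] x - x‖ ≤ η := by
  obtain ⟨C, hC1, hC⟩ := H.bounds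
  have hr := H.hr
  have hC0 : 0 < C := by linarith
  have hR2 := H.R2nn
  set CL := 32 * R2 / r^2 with hCLd
  have hCL : 0 ≤ CL := by positivity
  obtain ⟨s, hs0, hs1, hs2, hs3⟩ : ∃ s > 0, s ≤ η ∧ s < r/8 ∧ CL * s ≤ 1 / (2*C) := by
    refine ⟨min (min η (r/16)) (1 / (2*C*(CL+1))), by positivity, (min_le_left _ _).trans (min_le_left _ _),
      ((min_le_left _ _).trans (min_le_right _ _)).trans_lt (by linarith), ?_⟩
    calc _ ≤ CL * (1 / (2*C*(CL+1))) := by gcongr; exact min_le_right _ _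
      _ ≤ (CL+1) * (1 / (2*C*(CL+1))) := by gcongr; linarith
      _ = _ := by field_simp
  obtain ⟨i, j, hij, hp⟩ := H.pigeon (s / (2*C)) (by positivity)
  refine ⟨j - i, by omega, fun x hx => ?_⟩
  have hx4 : x ∈ ball q (r/4) := ball_subset_ball (by linarith) hx
  have hxh : x ∈ ball q (r/2) := ball_subset_ball (by linarith) hx
  have hball : closedBall x s ⊆ ball q (r/4) := by
    intro z hz
    rw [mem_closedBall] at hz; rw [mem_ball] at *
    linarith [dist_triangle z x q]
  have hdi := H.hf.diff
  have happ : ApproximatesLinearOn (f^[i]) (fderiv ℂ (f^[i]) x) (closedBall x s) ⟨CL * s, by positivity⟩ := by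
    intro y hy z hz
    refine (convex_closedBall x s).norm_image_sub_le_of_norm_fderiv_le' (fun w _ => hdi.iterate i w) (fun w hw => ?_) hz hy
    refine (cau2 (hdi.iterate i) hr (fun z hz => H.bd z hz i) hx4 (hball hw)).trans ?_
    change CL * ‖w - x‖ ≤ CL * s
    rw [mem_closedBall, dist_eq_norm] at hw
    gcongr
  let inv : (fderiv ℂ (f^[i]) x).NonlinearRightInverse :=
    { toFun := fderiv ℂ (g^[i]) (f^[i] x)
      nnnorm := ⟨C, hC0.le⟩
      bound' := fun y => opl (hC x hxh i).2 le_rfl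
      right_inv' := fun y => by
        have := congrArg (fun L : En n →L[ℂ] En n => L y) (DI_eq hdi H.hg.diff H.hgf H.hfg i x)
        simpa using this }
  have hsurj := happ.surjOn_closedBall_of_nonlinearRightInverse inv hs0.le (Subset.refl _)
  have hmem : f^[j] x ∈ closedBall (f^[i] x) ((((inv.nnnorm : NNReal) : ℝ)⁻¹ - ((⟨CL * s, by positivity⟩ : NNReal) : ℝ)) * s) := by
    rw [mem_closedBall, dist_eq_norm]
    refine (hp x hx4).trans ?_
    change s / (2*C) ≤ (C⁻¹ - CL * s) * s
    have : C⁻¹ - CL * s ≥ 1/(2*C) := by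
      have : C⁻¹ = 1/(2*C) + 1/(2*C) := by field_simp; norm_num
      linarith
    calc s/(2*C) = 1/(2*C) * s := by ring
      _ ≤ _ := by gcongr
  obtain ⟨w, hw, hwe⟩ := hsurj hmem
  have : f^[j] x = f^[i] (f^[j-i] x) := by rw [← iterate_add_apply]; congr 2; omega
  rw [this] at hwe
  have hwx := (H.hf.inj.iterate i) hwe
  rw [← hwx, ← dist_eq_norm]
  exact (mem_closedBall.mp hw).trans hs1

theorem Esc.period {n : ℕ} (hn : 1 ≤ n) {f g : En n → En n} {q : En n} {r R R2 ε : ℝ} (H : Esc f g q r R R2 ε) :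
    ∃ m : ℕ, 1 ≤ m ∧ ∀ x ∈ ball q (r/16), f^[m] x = x := by
  obtain ⟨C1, hC1, hq⟩ := H.quad
  have hr := H.hr
  set K := r/32 + 2 with hK
  have hK0 : 0 < K := by positivity
  obtain ⟨η, hη, hη1, hη2, hη3⟩ : ∃ η > 0, 256 * C1 * K^2 * η ≤ (r/8)^2 ∧ 4 * η * K ≤ r/8 ∧ η ≤ r/8 := by
    refine ⟨min (min ((r/8)^2 / (256 * C1 * K^2)) (r/8/(4*K))) (r/8), by positivity, ?_, ?_, min_le_right _ _⟩
    · calc _ ≤ 256 * C1 * K^2 * ((r/8)^2 / (256 * C1 * K^2)) := by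
            gcongr; exact (min_le_left _ _).trans (min_le_left _ _)
        _ = _ := by field_simp
    · calc _ ≤ 4 * (r/8/(4*K)) * K := by
            gcongr; exact (min_le_left _ _).trans (min_le_right _ _)
        _ = _ := by field_simp
  obtain ⟨m, hm1, hm⟩ := H.recur η hη
  refine ⟨m, hm1, ?_⟩
  have hn1 : (1:ℝ) ≤ n := by exact_mod_cast hn
  have key : ∀ i : ℕ, ∀ x ∈ ball q (r/16 + r/16/2^i), ‖f^[m] x - x‖ ≤ η / 16^i := by
    intro i
    induction i with
    | zero => 
      intro x hx
      simpa using hm x (by simpa using ball_subset_ball (by simp; linarith) hx)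
    | succ i ih =>
      intro x hx
      have h2i : (1:ℝ) ≤ 2^i := one_le_pow₀ (by norm_num)
      set d := r/16/2^(i+1) with hd
      have hd0 : 0 < d := by positivity
      have hdd : r/16/2^i = d + d := by rw [hd, pow_succ]; field_simp; norm_num
      have hd32 : d ≤ r/32 := by
        rw [hd, pow_succ, div_div, div_le_div_iff₀ (by positivity) (by positivity)]; nlinarith
      have hxs : x ∈ ball q (r/16 + r/16/2^i) := ball_subset_ball (by rw [hdd]; linarith) hx
      have hx1 := ih x hxs
      have hx8 : x ∈ ball q (r/8) := ball_subset_ball (by linarith) hx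
      have hder : ‖fderiv ℂ (f^[m]) x - ContinuousLinearMap.id ℂ (En n)‖ ≤ 2 * (η/16^i) / d := by
        have hdi : Differentiable ℂ (fun z => f^[m] z - z) := (H.hf.diff.iterate m).sub differentiable_id
        have h1 : fderiv ℂ (fun z => f^[m] z - z) x = fderiv ℂ (f^[m]) x - ContinuousLinearMap.id ℂ (En n) := by
          have := ((H.hf.diff.iterate m) x).hasFDerivAt.sub (hasFDerivAt_id x)
          exact this.fderiv
        rw [← h1]
        refine cau1 hdi hd0 fun z hz => ih z ?_
        rw [mem_ball] at *
        rw [hdd]; linarith [dist_triangle z x q]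
      set ei := η / 16^i with hei
      have hei0 : 0 < ei := by positivity
      have hee : ei ≤ ei * K / d := by
        rw [le_div_iff₀ hd0]; gcongr; linarith
      have hee2 : 2 * ei / d ≤ ei * K / d := by
        gcongr ?_ / d; nlinarith
      have he1 : ei * K / d ≤ 1 := by
        rw [div_le_one hd0, hei, hd, div_mul_eq_mul_div, div_le_div_iff₀ (by positivity) (by positivity)]
        have : (2:ℝ)^(i+1) ≤ 2 * 16^i := by
          rw [pow_succ, mul_comm]; gcongr; norm_num
        calc η * K * 2^(i+1) ≤ η * K * (2 * 16^i) := by gcongr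
          _ = (2 * η * K) * 16^i := by ring
          _ ≤ r/16 * 16^i := by gcongr; linarith
      have hfx : f^[m] x ∈ ball q (r/4) := by
        have := hm x hx8
        rw [← dist_eq_norm] at this
        rw [mem_ball] at *
        linarith [dist_triangle (f^[m] x) x q]
      have := hq m x (ball_subset_ball (by linarith) hx8) hfx _ he1 (hx1.trans hee) (hder.trans hee2)
      have h3 : ‖f^[m] x - x‖ ≤ C1 * (ei * K / d)^2 := by
        refine le_trans ?_ this
        exact le_mul_of_one_le_left (norm_nonneg _) hn1
      refine h3.trans ?_
      have h4 : C1 * (ei * K / d)^2 = (256 * C1 * K^2 * η) * (η / 16^(i+1)) * (4^i/16^i) / (r/8)^2 := by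
        rw [hei, hd]
        have : (4:ℝ)^i = 2^i * 2^i := by rw [← mul_pow]; norm_num
        rw [this]
        field_simp
        ring
      rw [h4, div_le_iff₀ (by positivity)]
      have h5 : (4:ℝ)^i/16^i ≤ 1 := by
        rw [div_le_one (by positivity)]; gcongr; norm_num
      calc _ ≤ (r/8)^2 * (η / 16^(i+1)) * 1 := by gcongr
        _ = _ := by ring
  intro x hx
  have h1 : Tendsto (fun i : ℕ => η / 16^i) atTop (𝓝 0) := by
    have := (tendsto_pow_atTop_nhds_zero_of_lt_one (r := (1/16:ℝ)) (by norm_num) (by norm_num)).const_mul η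
    simpa [div_eq_mul_inv] using this
  have h2 : ‖f^[m] x - x‖ ≤ 0 := ge_of_tendsto' h1 fun i => key i x (ball_subset_ball (by
    have : 0 < r/16/2^i := by positivity
    linarith) hx)
  exact sub_eq_zero.mp (norm_le_zero_iff.mp h2)

theorem dense_dual {n : ℕ} (V : Set (En n)) (hV : V.Finite) (h0 : ∀ v ∈ V, v ≠ 0) :
    Dense {l : En n →L[ℂ] ℂ | ∀ v ∈ V, l v ≠ 0} := by
  have e : {l : En n →L[ℂ] ℂ | ∀ v ∈ V, l v ≠ 0} = ⋂ v ∈ V, {l : En n →L[ℂ] ℂ | l v ≠ 0} := by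
    ext l; simp
  rw [e]
  refine dense_biInter_of_isOpen (fun v _ => ?_) hV.countable (fun v hv => ?_)
  · exact isOpen_ne_fun (ContinuousLinearMap.apply ℂ ℂ v).continuous continuous_const
  · let S := LinearMap.ker (ContinuousLinearMap.apply ℂ ℂ v : (En n →L[ℂ] ℂ) →L[ℂ] ℂ).toLinearMap
    have : {l : En n →L[ℂ] ℂ | l v ≠ 0} = (S : Set (En n →L[ℂ] ℂ))ᶜ := by
      ext l; simp [S]
    rw [this, ← interior_eq_empty_iff_dense_compl]
    by_contra hcon
    have hS := Submodule.eq_top_of_nonempty_interior' S (nonempty_iff_ne_empty.mpr hcon)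
    have h1 : innerSL ℂ v ∈ S := by rw [hS]; trivial
    have : inner ℂ v v = 0 := by simpa [S] using h1
    exact h0 v hv (inner_self_eq_zero.mp this)

theorem exists_ker {n : ℕ} (hn : 2 ≤ n) (l : En n →L[ℂ] ℂ) : ∃ v ≠ 0, l v = 0 := by
  have : LinearMap.ker l.toLinearMap ≠ ⊥ := LinearMap.ker_ne_bot_of_finrank_lt (by simp; omega)
  obtain ⟨v, hv, hv0⟩ := Submodule.exists_mem_ne_zero_of_ne_bot this
  exact ⟨v, hv0, by simpa using hv⟩

theorem min_ex {P : ℕ → Prop} (h : ∃ m, P m) : ∃ m, P m ∧ ∀ j < m, ¬ P j := by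
  classical
  exact ⟨Nat.find h, Nat.find_spec h, fun j hj => Nat.find_min h hj⟩

theorem Esc.false {n : ℕ} (hn : 2 ≤ n) {f g : En n → En n} {q : En n} {r R R2 ε : ℝ} (H : Esc f g q r R R2 ε) : False := by
  classical
  have hex : ∃ m : ℕ, 1 ≤ m ∧ ∃ U : Set (En n), IsOpen U ∧ U.Nonempty ∧ U ⊆ ball q (r/2) ∧ ∀ x ∈ U, f^[m] x = x := by
    obtain ⟨m, hm, h⟩ := H.period (by omega)
    have := H.hr
    exact ⟨m, hm, ball q (r/16), isOpen_ball, ⟨q, mem_ball_self (by positivity)⟩, ball_subset_ball (by linarith), h⟩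
  obtain ⟨m, ⟨hm1, U, hUo, hUn, hUs, hU⟩, hmin⟩ := min_ex hex
  have hk : ∀ k ≤ m, ∃ W ⊆ U, IsOpen W ∧ W.Nonempty ∧ ∀ x ∈ W, ∀ j, 0 < j → j < k → f^[j] x ≠ x := by
    intro k
    induction k with
    | zero => exact fun _ => ⟨U, Subset.refl _, hUo, hUn, fun _ _ j _ h => by omega⟩
    | succ k ih =>
      intro hkm
      obtain ⟨W, hWU, hWo, hWn, hW⟩ := ih (by omega)
      rcases Nat.eq_zero_or_pos k with rfl | hk0
      · exact ⟨W, hWU, hWo, hWn, fun x hx j h1 h2 => by omega⟩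
      · have h1 := hmin k (by omega)
        have h2 : ∃ x ∈ W, f^[k] x ≠ x := by
          by_contra hcon
          push Not at hcon
          exact h1 ⟨hk0, W, hWo, hWn, hWU.trans hUs, hcon⟩
        obtain ⟨x, hx, hxk⟩ := h2
        refine ⟨W ∩ {y | f^[k] y ≠ y}, fun y hy => hWU hy.1, hWo.inter 
          (isOpen_ne_fun (H.hf.diff.iterate k).continuous continuous_id), ⟨x, hx, hxk⟩, ?_⟩
        intro y hy j h1 h2
        rcases Nat.lt_succ_iff_lt_or_eq.mp h2 with h3 | rfl
        · exact hW y hy.1 j h1 h3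
        · exact hy.2
  obtain ⟨W, hWU, hWo, ⟨x, hx⟩, hW⟩ := hk m le_rfl
  have hxU := hWU hx
  obtain ⟨l, hl⟩ := (dense_dual ((fun j => x - f^[j] x) '' (Finset.Ioo 0 m : Set ℕ)) 
    ((Finset.finite_toSet _).image _) (by
      rintro v ⟨j, hj, rfl⟩
      rw [Finset.mem_coe, Finset.mem_Ioo] at hj
      exact sub_ne_zero.mpr (hW x hx j hj.1 hj.2).symm)).nonempty
  obtain ⟨v, hv0, hlv⟩ := exists_ker hn l
  let h : ℂ → ℂ := fun ζ => ∏ j ∈ Finset.Ioo 0 m, (ζ - l (f^[j] x))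
  have hh : Differentiable ℂ h := by
    intro z
    exact DifferentiableAt.fun_finset_prod fun j _ => (differentiableAt_id.sub_const _)
  have hx0 : h (l x) ≠ 0 := by
    refine Finset.prod_ne_zero_iff.mpr fun j hj => ?_
    rw [← map_sub]
    exact hl _ ⟨j, hj, rfl⟩
  have hxj : ∀ j, 0 < j → j < m → h (l (f^[j] x)) = 0 := fun j h1 h2 =>
    Finset.prod_eq_zero (i := j) (Finset.mem_Ioo.mpr ⟨h1, h2⟩) (by simp)
  obtain ⟨C, hC⟩ := H.shear_bdd l v hlv hh
  have hfix : ∀ k, ∀ y ∈ U, f^[k*m] y = y := by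
    intro k y hy
    rw [mul_comm, iterate_mul]
    exact iterate_fixed (hU y hy) k
  have hDg : ∀ k, fderiv ℂ (g^[k*m]) x = ContinuousLinearMap.id ℂ (En n) := by
    intro k
    have h1 := ID_eq H.hf.diff H.hg.diff H.hgf (k*m) x
    rw [hfix k x hxU] at h1
    have h2 : f^[k*m] =ᶠ[𝓝 x] id := by
      filter_upwards [hUo.mem_nhds hxU] with y hy using hfix k y hy
    rw [h2.fderiv_eq, fderiv_id] at h1
    exact h1
  have hS : ∀ k : ℕ, SN f g (fun z => h (l z) • v) (k*m) x = (k:ℂ) • (h (l x) • v) := by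
    intro k
    induction k with
    | zero => simp [SN]
    | succ k ih =>
      rw [SN] at ih ⊢
      rw [Nat.succ_mul, Finset.sum_range_add, ih, Finset.sum_eq_single 0]
      · rw [add_zero, hfix k x hxU, hDg]
        push_cast
        rw [add_smul, one_smul]; rfl
      · intro j hj hj0
        have : f^[k*m + j] x = f^[j] x := by rw [add_comm, iterate_add_apply, hfix k x hxU]
        rw [this, hxj j (Nat.pos_of_ne_zero hj0) (Finset.mem_range.mp hj)]
        simp
      · intro h; simp at h; omega
  have hpos : 0 < ‖h (l x) • v‖ := norm_pos_iff.mpr (smul_ne_zero hx0 hv0)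
  obtain ⟨k, hkk⟩ := exists_nat_gt (C / ‖h (l x) • v‖)
  rw [div_lt_iff₀ hpos] at hkk
  have := hC (k*m) x (hUs hxU)
  rw [hS, norm_smul, Complex.norm_natCast] at this
  linarith

theorem escape {n : ℕ} (hn : 2 ≤ n) {f : En n → En n} (hf : VAut f) (R ε : ℝ) (hε : 0 < ε) (q : En n) (r : ℝ) (hr : 0 < r) (R2 : ℝ) :
    ∃ G, VAut G ∧ Near f R ε G ∧ ∃ x ∈ ball q r, ∃ N : ℕ, R2 < ‖G^[N] x‖ := by
  by_contra hcon
  push Not at hcon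
  obtain ⟨g, hg, hgf, hfg⟩ := hf.exists_inv
  exact Esc.false hn (⟨hf, hg, hgf, hfg, hr, hε, hcon⟩ : Esc f g q r R R2 ε)

theorem damp {ρ : ℝ} {c : ℂ} (hρ : 0 ≤ ρ) (hc : ρ < ‖c‖) {Q : ℂ → ℂ} (hQ : Continuous Q) {η : ℝ} (hη : 0 < η) :
    ∃ M0 : ℕ, ∀ M ≥ M0, ∀ ζ : ℂ, ‖ζ‖ ≤ ρ → ‖(ζ/c)^M * Q ζ‖ < η := by
  obtain ⟨B, hB⟩ := (isCompact_closedBall (0:ℂ) ρ).exists_bound_of_continuousOn hQ.continuousOn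
  have hc0 : 0 < ‖c‖ := by linarith
  have hB0 : 0 ≤ B := (norm_nonneg _).trans (hB 0 (by simpa using hρ))
  have h1 : ρ/‖c‖ < 1 := by rwa [div_lt_one hc0]
  have ht := (tendsto_pow_atTop_nhds_zero_of_lt_one (r := ρ/‖c‖) (by positivity) h1).mul_const B
  rw [zero_mul] at ht
  obtain ⟨M0, hM0⟩ := eventually_atTop.mp (ht.eventually_lt_const hη)
  refine ⟨M0, fun M hM ζ hζ => lt_of_le_of_lt ?_ (hM0 M hM)⟩
  rw [norm_mul, norm_pow, norm_div]
  gcongr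
  exact hB ζ (by simpa using hζ)

theorem shear_step {n : ℕ} {f G : En n → En n} (hf : VAut f) (hG : VAut G) {R ε : ℝ} (hR : 0 ≤ R) (hN : Near f R ε G)
    (l : En n →L[ℂ] ℂ) (v : En n) (hlv : l v = 0) (c : ℂ) (hc : ‖l‖ * R < ‖c‖) {Q : ℂ → ℂ} (hQ : Differentiable ℂ Q) :
    ∃ M : ℕ, VAut (G ∘ fun z => z + ((l z / c)^M * Q (l z)) • v) ∧ 
      Near f R ε (G ∘ fun z => z + ((l z / c)^M * Q (l z)) • v) := by
  obtain ⟨η, hη, hηp⟩ := hN.perturb hf.diff.continuous hG.diff.continuous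
  obtain ⟨M, hM⟩ := damp (ρ := ‖l‖ * R) (by positivity) hc hQ.continuous (η := η / (‖v‖ + 1)) (by positivity)
  have hd : Differentiable ℂ fun ζ : ℂ => (ζ/c)^M * Q ζ := by fun_prop
  refine ⟨M, hG.comp (shear_VAut l v hlv hd), hηp _ fun z hz => ?_⟩
  rw [dist_eq_norm, add_sub_cancel_left, norm_smul]
  have h1 := hM M le_rfl (l z) ((l.le_opNorm z).trans (by gcongr; simpa using hz))
  calc _ ≤ η / (‖v‖+1) * ‖v‖ := by gcongr
    _ < η / (‖v‖+1) * (‖v‖+1) := by gcongr; linarith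
    _ = η := by field_simp

theorem step_move {n : ℕ} {f G : En n → En n} (hf : VAut f) (hG : VAut G) {R ε : ℝ} (hR : 0 ≤ R) (hN : Near f R ε G)
    (F : Finset (En n)) (l : En n →L[ℂ] ℂ) (a v : En n) (hlv : l v = 0) (ha : ‖l‖ * R < ‖l a‖) 
    (hF : ∀ y ∈ F, l (a - y) ≠ 0) :
    ∃ G', VAut G' ∧ Near f R ε G' ∧ (∀ y ∈ F, G' y = G y) ∧ G' a = G (a + v) := by
  have hla : l a ≠ 0 := by
    rw [← norm_pos_iff]; exact lt_of_le_of_lt (by positivity) ha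
  let P : ℂ → ℂ := fun ζ => ∏ y ∈ F, (ζ - l y)
  have hP : Differentiable ℂ P := fun z => DifferentiableAt.fun_finset_prod fun j _ => (differentiableAt_id.sub_const _)
  have hPa : P (l a) ≠ 0 := Finset.prod_ne_zero_iff.mpr fun y hy => by rw [← map_sub]; exact hF y hy
  have hPy : ∀ y ∈ F, P (l y) = 0 := fun y hy => Finset.prod_eq_zero hy (by simp)
  obtain ⟨M, h1, h2⟩ := shear_step hf hG hR hN l v hlv (l a) ha (hP.div_const (P (l a)))
  refine ⟨_, h1, h2, fun y hy => ?_, ?_⟩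
  · simp [hPy y hy]
  · simp [div_self hla, div_self hPa]

theorem step_deriv {n : ℕ} {f G : En n → En n} (hf : VAut f) (hG : VAut G) {R ε : ℝ} (hR : 0 ≤ R) (hN : Near f R ε G)
    (F : Finset (En n)) (l : En n →L[ℂ] ℂ) (a v : En n) (hlv : l v = 0) (ha : ‖l‖ * R < ‖l a‖) 
    (hF : ∀ y ∈ F, l (a - y) ≠ 0) :
    ∃ G', VAut G' ∧ Near f R ε G' ∧ (∀ y ∈ F, G' y = G y) ∧ G' a = G a ∧ 
      fderiv ℂ G' a = (fderiv ℂ G a).comp (ContinuousLinearMap.id ℂ (En n) + l.smulRight v) := by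
  have hla : l a ≠ 0 := by
    rw [← norm_pos_iff]; exact lt_of_le_of_lt (by positivity) ha
  let P : ℂ → ℂ := fun ζ => ∏ y ∈ F, (ζ - l y)
  have hP : Differentiable ℂ P := fun z => DifferentiableAt.fun_finset_prod fun j _ => (differentiableAt_id.sub_const _)
  have hPa : P (l a) ≠ 0 := Finset.prod_ne_zero_iff.mpr fun y hy => by rw [← map_sub]; exact hF y hy
  have hPy : ∀ y ∈ F, P (l y) = 0 := fun y hy => Finset.prod_eq_zero hy (by simp)
  have hQ : Differentiable ℂ fun ζ => (ζ - l a) * (P ζ / P (l a)) := 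
    (differentiable_id.sub_const _).mul (hP.div_const (P (l a)))
  obtain ⟨M, h1, h2⟩ := shear_step hf hG hR hN l v hlv (l a) ha hQ
  refine ⟨_, h1, h2, fun y hy => ?_, ?_, ?_⟩
  · simp [hPy y hy]
  · simp
  · have hh : Differentiable ℂ fun ζ : ℂ => (ζ / l a)^M * ((ζ - l a) * (P ζ / P (l a))) := by fun_prop
    have hd : HasDerivAt (fun ζ : ℂ => (ζ / l a)^M * ((ζ - l a) * (P ζ / P (l a)))) 1 (l a) := by
      have e : (fun ζ : ℂ => (ζ / l a)^M * ((ζ - l a) * (P ζ / P (l a)))) = 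
        fun ζ : ℂ => (ζ - l a) * ((ζ / l a)^M * (P ζ / P (l a))) := by funext ζ; ring
      rw [e]
      have hk : Differentiable ℂ fun ζ : ℂ => ((ζ / l a)^M * (P ζ / P (l a))) := by fun_prop
      have := ((hasDerivAt_id (l a)).sub_const (l a)).mul (hk (l a)).hasDerivAt
      refine HasDerivAt.congr_deriv this ?_
      simp [div_self hla, div_self hPa]
    have hs := shear_hasFDerivAt l v hh a
    rw [hd.deriv, one_smul] at hs
    have e0 : a + ((l a / l a)^M * ((l a - l a) * (P (l a) / P (l a)))) • v = a := by simp
    have hGa : HasFDerivAt G (fderiv ℂ G a) (a + ((l a / l a)^M * ((l a - l a) * (P (l a) / P (l a)))) • v) := by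
      rw [e0]; exact (hG.diff a).hasFDerivAt
    exact (hGa.comp a hs).fderiv

theorem good_open {n : ℕ} {R : ℝ} (a : En n) (ha : R < ‖a‖) (ha0 : a ≠ 0) (V : Set (En n)) (hV : V.Finite) (h0 : ∀ v ∈ V, v ≠ 0) :
    IsOpen {l : En n →L[ℂ] ℂ | ‖l‖ * R < ‖l a‖ ∧ ∀ v ∈ V, l v ≠ 0} ∧ 
    {l : En n →L[ℂ] ℂ | ‖l‖ * R < ‖l a‖ ∧ ∀ v ∈ V, l v ≠ 0}.Nonempty := by
  have ho : IsOpen {l : En n →L[ℂ] ℂ | ‖l‖ * R < ‖l a‖} := 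
    isOpen_lt (by fun_prop) (continuous_norm.comp (ContinuousLinearMap.apply ℂ ℂ a).continuous)
  constructor
  · have e : {l : En n →L[ℂ] ℂ | ‖l‖ * R < ‖l a‖ ∧ ∀ v ∈ V, l v ≠ 0} = {l : En n →L[ℂ] ℂ | ‖l‖ * R < ‖l a‖} ∩ ⋂ v ∈ V, {l : En n →L[ℂ] ℂ | l v ≠ 0} := by
      ext l; simp
    rw [e]
    refine ho.inter (hV.isOpen_biInter fun v _ => ?_)
    exact isOpen_ne_fun (ContinuousLinearMap.apply ℂ ℂ v).continuous continuous_const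
  · obtain ⟨l, h1, h2⟩ := (dense_dual V hV h0).inter_open_nonempty _ ho ⟨innerSL ℂ a, by
      have hp : 0 < ‖a‖ := norm_pos_iff.mpr ha0
      simp only [mem_setOf_eq, innerSL_apply_norm, innerSL_apply_apply]
      rw [inner_self_eq_norm_sq_to_K]
      simp only [norm_pow, Complex.coe_algebraMap, Complex.norm_real, norm_norm]
      nlinarith⟩
    exact ⟨l, h1, h2⟩

theorem move {n : ℕ} (hn : 2 ≤ n) {f G : En n → En n} (hf : VAut f) (hG : VAut G) {R ε : ℝ} (hR : 0 ≤ R) (hN : Near f R ε G)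
    (F : Finset (En n)) (a b : En n) (ha : R < ‖a‖) (hb : R < ‖b‖) (haF : a ∉ F) (hbF : b ∉ F) :
    ∃ G', VAut G' ∧ Near f R ε G' ∧ (∀ y ∈ F, G' y = G y) ∧ G' a = G b := by
  classical
  have ha0 : a ≠ 0 := by rintro rfl; simp at ha; linarith
  have hb0 : b ≠ 0 := by rintro rfl; simp at hb; linarith
  obtain ⟨l1, h1, h1F⟩ := (good_open a ha ha0 ((F.image fun y => a - y : Finset (En n)) : Set (En n)) (Finset.finite_toSet _) (by
    intro v hv
    obtain ⟨y, hy, rfl⟩ := Finset.mem_image.mp hv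
    exact sub_ne_zero.mpr (fun h => haF (h ▸ hy)))).2
  obtain ⟨u, hu0, hu⟩ := exists_ker hn l1
  obtain ⟨l2, h2, h2F⟩ := (good_open b hb hb0 ((insert u (F.image fun y => b - y) : Finset (En n)) : Set (En n)) (Finset.finite_toSet _) (by
    intro v hv
    rcases Finset.mem_insert.mp hv with rfl | hv
    · exact hu0
    obtain ⟨y, hy, rfl⟩ := Finset.mem_image.mp hv
    exact sub_ne_zero.mpr (fun h => hbF (h ▸ hy)))).2
  have hl2u : l2 u ≠ 0 := h2F u (by simp)
  set c := (l2 b - l2 a) / l2 u with hc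
  set w := a + c • u with hw
  have hl2w : l2 w = l2 b := by rw [hw, map_add, map_smul, smul_eq_mul, hc, div_mul_cancel₀ _ hl2u]; ring
  obtain ⟨G1, hG1, hN1, hF1, hw1⟩ := step_move hf hG hR hN F l2 w (b - w) (by rw [map_sub, hl2w, sub_self]) 
    (by rw [hl2w]; exact h2) (by
      intro y hy
      rw [map_sub, hl2w, ← map_sub]
      exact h2F _ (by simp only [Finset.coe_insert, Finset.coe_image]; exact Or.inr ⟨y, hy, rfl⟩))
  obtain ⟨G2, hG2, hN2, hF2, hw2⟩ := step_move hf hG1 hR hN1 F l1 a (c • u) (by rw [map_smul, hu, smul_zero]) h1 (by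
      intro y hy
      exact h1F _ (by rw [Finset.coe_image]; exact ⟨y, hy, rfl⟩))
  refine ⟨G2, hG2, hN2, fun y hy => (hF2 y hy).trans (hF1 y hy), ?_⟩
  rw [hw2, ← hw, hw1, add_sub_cancel]

theorem dual_finrank (n : ℕ) : Module.finrank ℂ (En n →L[ℂ] ℂ) = n := by
  have := (LinearMap.toContinuousLinearMap (𝕜 := ℂ) (E := En n) (F' := ℂ)).finrank_eq
  rw [← this]
  have h2 : Module.finrank ℂ (En n →ₗ[ℂ] ℂ) = Module.finrank ℂ (En n) := Subspace.dual_finrank_eq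
  rw [h2]; simp

theorem exists_coord {n : ℕ} (U : Set (En n →L[ℂ] ℂ)) (hU : IsOpen U) (hne : U.Nonempty) :
    ∃ (lam : Fin n → (En n →L[ℂ] ℂ)) (T : En n ≃ₗ[ℂ] (Fin n → ℂ)), (∀ j, lam j ∈ U) ∧ ∀ z j, T z j = lam j z := by
  have hsp : ⊤ ≤ Submodule.span ℂ U := by
    rw [top_le_iff]
    apply Submodule.eq_top_of_nonempty_interior'
    obtain ⟨l, hl⟩ := hne
    exact ⟨l, mem_interior.mpr ⟨U, Submodule.subset_span, hU, hl⟩⟩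
  let B0 := Module.Basis.ofSpan hsp
  let B1 := Module.finBasisOfFinrankEq ℂ (En n →L[ℂ] ℂ) (dual_finrank n)
  let B := B0.reindex (B0.indexEquiv B1)
  let T0 : En n →ₗ[ℂ] (Fin n → ℂ) := LinearMap.pi fun j => (B j).toLinearMap
  have hinj : Injective T0 := by
    rw [← LinearMap.ker_eq_bot, LinearMap.ker_eq_bot']
    intro z hz
    have h1 : ∀ j, B j z = 0 := fun j => congrFun hz j
    have h2 : innerSL ℂ z z = 0 := by
      have h3 := congrArg (fun L : En n →L[ℂ] ℂ => L z) (B.sum_repr (innerSL ℂ z))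
      simp only [ContinuousLinearMap.sum_apply, ContinuousLinearMap.smul_apply, h1, smul_zero, Finset.sum_const_zero] at h3
      exact h3.symm
    simpa using h2
  refine ⟨B, LinearMap.linearEquivOfInjective T0 hinj (by simp), fun j => ?_, fun z j => ?_⟩
  · apply Module.Basis.ofSpan_subset hsp
    simp only [B, Module.Basis.reindex_apply]
    exact ⟨_, rfl⟩
  · rfl

theorem diag2n_eq {n : ℕ} {i j : Fin n} (hij : i ≠ j) {a : ℂ} (ha : a ≠ 0) :
    Matrix.SpecialLinearGroup.diag2n hij a ha = 
      Matrix.SpecialLinearGroup.transvection hij.symm ((1-a)/a) * 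
      (Matrix.SpecialLinearGroup.transvection hij 1 * 
      (Matrix.SpecialLinearGroup.transvection hij.symm (a-1) * 
      Matrix.SpecialLinearGroup.transvection hij (-1/a))) := by
  apply Subtype.ext
  apply Matrix.toLin'.injective
  apply LinearMap.ext
  intro v
  have htr : ∀ {i j : Fin n} (hij : i ≠ j) (c : ℂ) (w : Fin n → ℂ), 
    (Matrix.SpecialLinearGroup.transvection hij c).1.mulVec w = w + Pi.single i (c * w j) := by
    intro i j hij c w
    rw [Matrix.SpecialLinearGroup.transvection_coe, Matrix.add_mulVec, Matrix.one_mulVec, Matrix.single_mulVec]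
    rfl
  simp only [Matrix.toLin'_apply]
  change _ = (_ * (_ * (_ * _)) : Matrix (Fin n) (Fin n) ℂ).mulVec v
  rw [← Matrix.mulVec_mulVec, ← Matrix.mulVec_mulVec, ← Matrix.mulVec_mulVec, htr, htr, htr, htr, Matrix.SpecialLinearGroup.diag2n_coe]
  funext k
  rw [Matrix.mulVec_diagonal]
  by_cases hki : k = i
  · subst hki
    simp [hij, hij.symm]
    field_simp
    ring
  · by_cases hkj : k = j
    · subst hkj
      simp [hij, hij.symm]
      field_simp
      ring
    · simp [hki, hkj]

theorem set_deriv {n : ℕ} (hn : 2 ≤ n) {f : En n → En n} (hf : VAut f) {R ε : ℝ} (hR : 0 ≤ R) 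
    (F : Finset (En n)) (b : En n) (hb : R < ‖b‖) (hbF : b ∉ F) (N : En n →L[ℂ] En n) (hN1 : N.det = 1) 
    {G : En n → En n} (hG : VAut G) (hN : Near f R ε G) :
    ∃ G', VAut G' ∧ Near f R ε G' ∧ (∀ y ∈ F, G' y = G y) ∧ G' b = G b ∧ 
      fderiv ℂ G' b = (fderiv ℂ G b).comp N := by
  classical
  have hb0 : b ≠ 0 := by rintro rfl; simp at hb; linarith
  obtain ⟨ho, hne⟩ := good_open b hb hb0 ((F.image fun y => b - y : Finset (En n)) : Set (En n)) (Finset.finite_toSet _) (by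
    intro v hv
    obtain ⟨y, hy, rfl⟩ := Finset.mem_image.mp hv
    exact sub_ne_zero.mpr (fun h => hbF (h ▸ hy)))
  obtain ⟨lam, T, hlam, hT⟩ := exists_coord _ ho hne
  let op : Matrix (Fin n) (Fin n) ℂ → (En n →L[ℂ] En n) := fun A =>
    LinearMap.toContinuousLinearMap (T.symm.toLinearMap ∘ₗ Matrix.toLin' A ∘ₗ T.toLinearMap)
  have hop : ∀ A z, op A z = T.symm (A.mulVec (T z)) := fun A z => rfl
  have hopm : ∀ A B, op (A * B) = (op A).comp (op B) := by
    intro A B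
    ext1 z
    rw [ContinuousLinearMap.comp_apply, hop, hop, hop, T.apply_symm_apply, Matrix.mulVec_mulVec]
  let Ach : (En n →L[ℂ] En n) → Prop := fun N => ∀ G, VAut G → Near f R ε G → 
    ∃ G', VAut G' ∧ Near f R ε G' ∧ (∀ y ∈ F, G' y = G y) ∧ G' b = G b ∧ 
      fderiv ℂ G' b = (fderiv ℂ G b).comp N
  have hmul : ∀ A B, Ach A → Ach B → Ach (A.comp B) := by
    intro A B hA hB G hG hN
    obtain ⟨G1, g1, g2, g3, g4, g5⟩ := hA G hG hN
    obtain ⟨G2, k1, k2, k3, k4, k5⟩ := hB G1 g1 g2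
    refine ⟨G2, k1, k2, fun y hy => (k3 y hy).trans (g3 y hy), k4.trans g4, ?_⟩
    rw [k5, g5, ContinuousLinearMap.comp_assoc]
  have htv : ∀ (i j : Fin n) (hij : i ≠ j) (c : ℂ), Ach (op (Matrix.SpecialLinearGroup.transvection hij c).1) := by
    intro i j hij c G hG hN
    obtain ⟨h1, h2⟩ := hlam j
    have hlv : lam j (T.symm (Pi.single i c)) = 0 := by
      rw [← hT, T.apply_symm_apply]; simp [hij.symm]
    obtain ⟨G', k1, k2, k3, k4, k5⟩ := step_deriv hf hG hR hN F (lam j) b (T.symm (Pi.single i c)) hlv h1 (by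
      intro y hy
      exact h2 _ (by rw [Finset.coe_image]; exact ⟨y, hy, rfl⟩))
    refine ⟨G', k1, k2, k3, k4, ?_⟩
    rw [k5]
    congr 1
    ext1 z
    rw [hop, Matrix.SpecialLinearGroup.transvection_coe, Matrix.add_mulVec, Matrix.one_mulVec, Matrix.single_mulVec, map_add, T.symm_apply_apply]
    simp only [ContinuousLinearMap.add_apply, ContinuousLinearMap.id_apply, ContinuousLinearMap.smulRight_apply]
    congr 1
    rw [← map_smul, hT]
    congr 1
    funext k
    by_cases hk : k = i
    · subst hk; simp [mul_comm]
    · simp [hk]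
  have hnt : Nontrivial (Fin n) := Fin.nontrivial_iff_two_le.mpr hn
  have hall : ∀ M : Matrix.SpecialLinearGroup (Fin n) ℂ, Ach (op M.1) := by
    intro M
    have hmul' : ∀ A B : Matrix.SpecialLinearGroup (Fin n) ℂ, Ach (op A.1) → Ach (op B.1) → Ach (op (A * B).1) := by
      intro A B hA hB
      have : (A * B).1 = A.1 * B.1 := rfl
      rw [this, hopm]
      exact hmul _ _ hA hB
    refine Matrix.SpecialLinearGroup.diagonal_transvection_induction' (fun M => Ach (op M.1)) M ?_ htv hmul'
    intro i j hij c hc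
    rw [diag2n_eq hij hc]
    exact hmul' _ _ (htv _ _ _ _) (hmul' _ _ (htv _ _ _ _) (hmul' _ _ (htv _ _ _ _) (htv _ _ _ _)))
  let M0 := LinearMap.toMatrix' (T.toLinearMap ∘ₗ N.toLinearMap ∘ₗ T.symm.toLinearMap)
  have hM0 : M0.det = 1 := by
    rw [LinearMap.det_toMatrix', LinearMap.det_conj]
    exact hN1
  have := hall ⟨M0, hM0⟩
  have e : op M0 = N := by
    ext1 z
    rw [hop, ← Matrix.toLin'_apply, Matrix.toLin'_toMatrix']
    simp
  simp only [e] at this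
  exact this G hG hN

def Bnd (ρ : ℝ) (k : ℕ) : ℝ := if k = 0 then 3 * ρ else 6 / 5 * ρ

theorem stable {n : ℕ} {ρ : ℝ} (hρ : 0 < ρ) (i0 : Fin n) (μ : Fin n → ℂ) (hμ0 : ‖μ i0‖ ≤ 1/4)
    (hμ : ∀ i, i ≠ i0 → 4 ≤ ‖μ i‖) (R : ℕ → (Fin n → ℂ) → (Fin n → ℂ) → (Fin n → ℂ))
    (hR : ∀ k s s' u u', ‖s‖ ≤ 3 * ρ → ‖s'‖ ≤ 3 * ρ → ‖u‖ ≤ Bnd ρ k → ‖u'‖ ≤ Bnd ρ k →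
      ‖R k s u - R k s' u'‖ ≤ 1/8 * max ‖s - s'‖ ‖u - u'‖)
    (hR0 : ∀ k s, ‖s‖ ≤ 3 * ρ → R k s 0 = 0) (β : (Fin n → ℂ) → ℂ)
    (hβ : ∀ s, ‖s‖ ≤ 3 * ρ → ‖β s‖ ≤ 3 * ρ)
    (hβ' : ∀ s s', ‖s‖ ≤ 3 * ρ → ‖s'‖ ≤ 3 * ρ → ‖β s - β s'‖ ≤ 1/4 * ‖s - s'‖) :
    ∃ w : ℕ → (Fin n → ℂ), (∀ k, ‖w k‖ ≤ Bnd ρ k) ∧ w 0 i0 = β (w 0) ∧ 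
      (∀ k, w (k+1) = μ * w k + R k (w 0) (w k)) ∧ Tendsto w atTop (𝓝 0) := by
  have hB0 : ∀ k, 0 ≤ Bnd ρ k := by intro k; unfold Bnd; split_ifs <;> positivity
  have hB1 : ∀ k, Bnd ρ (k+1) = 6/5*ρ := by intro k; simp [Bnd]
  have hB2 : Bnd ρ 0 = 3*ρ := by simp [Bnd]
  have hB3 : ∀ k, 6/5*ρ ≤ Bnd ρ k := by intro k; unfold Bnd; split_ifs <;> linarith
  have hB4 : ∀ k, Bnd ρ k ≤ 3*ρ := by intro k; unfold Bnd; split_ifs <;> linarith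
  have hRb : ∀ k s u, ‖s‖ ≤ 3 * ρ → ‖u‖ ≤ Bnd ρ k → ‖R k s u‖ ≤ 1/8 * ‖u‖ := by
    intro k s u hs hu
    have := hR k s s u 0 hs hs hu (by simpa using hB0 k)
    rw [hR0 k s hs] at this
    simpa using this
  have hco : ∀ (v : Fin n → ℂ) i, ‖v i‖ ≤ ‖v‖ := fun v i => norm_le_pi_norm v i
  have hinv : ∀ i, i ≠ i0 → ‖(μ i)⁻¹‖ ≤ 1/4 := by
    intro i hi
    rw [norm_inv, one_div]
    exact inv_anti₀ (by norm_num) (hμ i hi)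
  let T : (ℕ → (Fin n → ℂ)) → ℕ → (Fin n → ℂ) := fun w k i => 
    if i = i0 then (Nat.casesOn k (β (w 0)) (fun k => μ i0 * w k i0 + R k (w 0) (w k) i0)) 
    else (μ i)⁻¹ * (w (k+1) i - R k (w 0) (w k) i)
  have T0 : ∀ w, T w 0 i0 = β (w 0) := fun w => by simp [T]
  have T1 : ∀ w k, T w (k+1) i0 = μ i0 * w k i0 + R k (w 0) (w k) i0 := fun w k => by simp [T]
  have T2 : ∀ w k i, i ≠ i0 → T w k i = (μ i)⁻¹ * (w (k+1) i - R k (w 0) (w k) i) := 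
    fun w k i hi => by simp [T, hi]
  clear_value T
  have b1 : ∀ (w : ℕ → (Fin n → ℂ)) k c, (∀ k, ‖w k‖ ≤ Bnd ρ k) → ‖w k‖ ≤ c →
      ‖T w (k+1) i0‖ ≤ 3/8 * c := by
    intro w k c hw hc
    rw [T1]
    have h1 := hRb k (w 0) (w k) (by rw [← hB2]; exact hw 0) (hw k)
    have h2 := (hco (R k (w 0) (w k)) i0).trans h1
    have h3 : ‖μ i0 * w k i0‖ ≤ 1/4 * ‖w k‖ := by
      rw [norm_mul]; exact mul_le_mul hμ0 (hco _ _) (norm_nonneg _) (by norm_num)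
    have := norm_add_le (μ i0 * w k i0) (R k (w 0) (w k) i0)
    linarith
  have b2 : ∀ (w : ℕ → (Fin n → ℂ)) k c i, i ≠ i0 → (∀ k, ‖w k‖ ≤ Bnd ρ k) → ‖w k‖ ≤ c →  ‖w (k+1)‖ ≤ c →
      ‖T w k i‖ ≤ 3/8 * c := by
    intro w k c i hi hw hc hc1
    rw [T2 _ _ _ hi]
    have h1 := hRb k (w 0) (w k) (by rw [← hB2]; exact hw 0) (hw k)
    have h2 := (hco (R k (w 0) (w k)) i).trans h1
    have h3 := norm_sub_le (w (k+1) i) (R k (w 0) (w k) i)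
    have h4 := hco (w (k+1)) i
    rw [norm_mul]
    calc _ ≤ 1/4 * (9/8 * c) := mul_le_mul (hinv i hi) (by linarith) (norm_nonneg _) (by norm_num)
      _ ≤ _ := by linarith [norm_nonneg (w k)]
  have hmaps : ∀ w : ℕ → (Fin n → ℂ), (∀ k, ‖w k‖ ≤ Bnd ρ k) → ∀ k, ‖T w k‖ ≤ Bnd ρ k := by
    intro w hw k
    rw [pi_norm_le_iff_of_nonneg (hB0 k)]
    intro i
    by_cases hi : i = i0
    · subst hi
      cases k with
      | zero => rw [T0, hB2]; exact hβ _ (by rw [← hB2]; exact hw 0)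
      | succ k => 
        refine (b1 w k _ hw ((hw k).trans (hB4 k))).trans ?_
        rw [hB1]; linarith
    · refine (b2 w k _ i hi hw ((hw k).trans (hB4 k)) ((hw _).trans (hB4 _))).trans ?_
      linarith [hB3 k]
  have hlip : ∀ w w' : ℕ → (Fin n → ℂ), (∀ k, ‖w k‖ ≤ Bnd ρ k) → (∀ k, ‖w' k‖ ≤ Bnd ρ k) → 
      ∀ d, (∀ k, ‖w k - w' k‖ ≤ d) → ∀ k, ‖T w k - T w' k‖ ≤ 1/2 * d := by
    intro w w' hw hw' d hd k
    have hd0 : 0 ≤ d := (norm_nonneg _).trans (hd 0)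
    have s1 : ‖w 0‖ ≤ 3*ρ := by rw [← hB2]; exact hw 0
    have s2 : ‖w' 0‖ ≤ 3*ρ := by rw [← hB2]; exact hw' 0
    have hr : ∀ k i, ‖R k (w 0) (w k) i - R k (w' 0) (w' k) i‖ ≤ 1/8 * d := by
      intro k i
      refine (hco (R k (w 0) (w k) - R k (w' 0) (w' k)) i).trans ?_
      refine (hR k _ _ _ _ s1 s2 (hw k) (hw' k)).trans ?_
      have : max ‖w 0 - w' 0‖ ‖w k - w' k‖ ≤ d := max_le (hd _) (hd _)
      linarith
    have hc : ∀ k i, ‖w k i - w' k i‖ ≤ d := fun k i => (hco (w k - w' k) i).trans (hd k)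
    rw [pi_norm_le_iff_of_nonneg (by linarith)]
    intro i
    rw [Pi.sub_apply]
    by_cases hi : i = i0
    · subst hi
      cases k with
      | zero => 
        rw [T0, T0]
        refine (hβ' _ _ s1 s2).trans ?_
        linarith [hd 0]
      | succ k => 
        rw [T1, T1]
        have e : μ i * w k i + R k (w 0) (w k) i - (μ i * w' k i + R k (w' 0) (w' k) i) = 
          μ i * (w k i - w' k i) + (R k (w 0) (w k) i - R k (w' 0) (w' k) i) := by ring
        rw [e]
        refine (norm_add_le _ _).trans ?_
        have h3 : ‖μ i * (w k i - w' k i)‖ ≤ 1/4 * d := by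
          rw [norm_mul]; exact mul_le_mul hμ0 (hc _ _) (norm_nonneg _) (by norm_num)
        linarith [hr k i]
    · rw [T2 _ _ _ hi, T2 _ _ _ hi]
      have e : (μ i)⁻¹ * (w (k+1) i - R k (w 0) (w k) i) - (μ i)⁻¹ * (w' (k+1) i - R k (w' 0) (w' k) i) = 
        (μ i)⁻¹ * ((w (k+1) i - w' (k+1) i) - (R k (w 0) (w k) i - R k (w' 0) (w' k) i)) := by ring
      rw [e, norm_mul]
      calc _ ≤ 1/4 * (d + 1/8*d) := mul_le_mul (hinv i hi) ((norm_sub_le _ _).trans (add_le_add (hc _ _) (hr _ _))) (norm_nonneg _) (by norm_num)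
        _ ≤ _ := by linarith
  -- fixed point
  let S : Set (BoundedContinuousFunction ℕ (Fin n → ℂ)) := {w | ∀ k, ‖w k‖ ≤ Bnd ρ k}
  have hS : IsClosed S := by
    have : S = ⋂ k, {w : BoundedContinuousFunction ℕ (Fin n → ℂ) | ‖w k‖ ≤ Bnd ρ k} := by
      ext w; simp [S]
    rw [this]
    refine isClosed_iInter fun k => isClosed_le ?_ continuous_const
    exact (continuous_eval_const k).norm
  have : CompleteSpace S := hS.completeSpace_coe
  have : Nonempty S := ⟨⟨0, fun k => by simpa using hB0 k⟩⟩
  let Φ : S → S := fun w => ⟨BoundedContinuousFunction.ofNormedAddCommGroupDiscrete (T w.1) (3*ρ) 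
    (fun k => (hmaps _ w.2 k).trans (hB4 k)), hmaps _ w.2⟩
  have hΦ : ContractingWith (1/2) Φ := by
    refine ⟨by rw [← NNReal.coe_lt_coe]; norm_num, LipschitzWith.of_dist_le_mul fun w w' => ?_⟩
    rw [Subtype.dist_eq, Subtype.dist_eq]
    rw [BoundedContinuousFunction.dist_le (by positivity)]
    intro k
    rw [dist_eq_norm]
    have := hlip w.1 w'.1 w.2 w'.2 (dist w.1 w'.1) (fun k => by rw [← dist_eq_norm]; exact BoundedContinuousFunction.dist_coe_le_dist k) k
    refine le_trans (le_of_eq ?_) (this.trans (le_of_eq ?_))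
    · rfl
    · congr 1
  obtain ⟨w, hw⟩ : ∃ w, Φ w = w := ⟨_, hΦ.fixedPoint_isFixedPt⟩
  have hfix : ∀ k, T w.1 k = w.1 k := by
    intro k
    conv_rhs => rw [← hw]
    rfl
  have hwS : ∀ k, ‖w.1 k‖ ≤ Bnd ρ k := w.2
  generalize (w.1 : ℕ → (Fin n → ℂ)) = v at hfix hwS
  refine ⟨v, hwS, ?_, ?_, ?_⟩
  · rw [← T0, hfix]
  · intro k
    funext i
    rw [Pi.add_apply, Pi.mul_apply]
    by_cases hi : i = i0
    · subst hi
      rw [← T1, hfix]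
    · have h1 := T2 v k i hi
      rw [hfix] at h1
      have hne : μ i ≠ 0 := by
        intro h; have := hμ i hi; rw [h, norm_zero] at this; norm_num at this
      rw [h1]
      field_simp
      ring
  · have key : ∀ m k : ℕ, m + 1 ≤ k → ‖v k‖ ≤ (1/2)^m * (6/5*ρ) := by
      intro m
      induction m with
      | zero => 
        intro k hk
        obtain ⟨k, rfl⟩ : ∃ j, k = j + 1 := ⟨k - 1, by omega⟩
        have := hwS (k+1)
        rw [hB1] at this
        simpa using this
      | succ m ih =>
        intro k hk
        obtain ⟨k, rfl⟩ : ∃ j, k = j + 1 := ⟨k - 1, by omega⟩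
        have hpos : (0:ℝ) ≤ (1/2)^m * (6/5*ρ) := by positivity
        rw [pi_norm_le_iff_of_nonneg (by positivity)]
        intro i
        rw [← hfix, pow_succ]
        by_cases hi : i = i0
        · subst hi
          have := b1 v k _ hwS (ih k (by omega))
          linarith
        · have := b2 v (k+1) _ i hi hwS (ih (k+1) (by omega)) (ih (k+1+1) (by omega))
          linarith
    rw [tendsto_zero_iff_norm_tendsto_zero]
    have h2 : Tendsto (fun k : ℕ => (1/2:ℝ)^(k-1) * (6/5*ρ)) atTop (𝓝 0) := by
      have := ((tendsto_pow_atTop_nhds_zero_of_lt_one (r := (1/2:ℝ)) (by norm_num) (by norm_num)).comp (tendsto_sub_atTop_nat 1)).mul_const (6/5*ρ)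
      simpa using this
    refine squeeze_zero' (Eventually.of_forall fun k => norm_nonneg _) ?_ h2
    filter_upwards [eventually_ge_atTop 1] with k hk
    exact key (k-1) k (by omega)

theorem bump (c : ℂ) (r1 : ℝ) (hr0 : 0 ≤ r1) (hr : r1 < ‖c‖) (Z : Finset ℂ) (hZ : c ∉ Z) {θ : ℝ} (hθ : 0 < θ) :
    ∃ h : ℂ → ℂ, Differentiable ℂ h ∧ h c = 1 ∧ (∀ ζ ∈ Z, h ζ = 0 ∧ deriv h ζ = 0) ∧ 
      ∀ ζ, ‖ζ‖ ≤ r1 → ‖h ζ‖ ≤ θ ∧ ‖deriv h ζ‖ ≤ θ := by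
  have hc0 : c ≠ 0 := by rintro rfl; simp at hr; linarith
  let P : ℂ → ℂ := fun ζ => ∏ z ∈ Z, (ζ - z)
  have hP : Differentiable ℂ P := by
    intro ζ
    exact DifferentiableAt.fun_finsetProd fun z _ => by fun_prop
  have hPz : ∀ ζ ∈ Z, P ζ = 0 := fun ζ hζ => Finset.prod_eq_zero hζ (sub_self _)
  have hPc : P c ≠ 0 := by
    refine Finset.prod_ne_zero_iff.mpr fun z hz => sub_ne_zero.mpr ?_
    rintro rfl; exact hZ hz
  clear_value P
  let r2 := (r1 + ‖c‖) / 2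
  let d := (‖c‖ - r1) / 2
  have hd : 0 < d := by simp only [d]; linarith
  obtain ⟨M, hM⟩ := damp (ρ := r2) (c := c) (by simp only [r2]; positivity) (by simp only [r2]; linarith) 
    (Q := fun ζ => P ζ ^ 2 / P c ^ 2) (by have := hP.continuous; fun_prop) 
    (η := min θ (θ * d / 2)) (by positivity)
  let h : ℂ → ℂ := fun ζ => (ζ / c) ^ M * (P ζ ^ 2 / P c ^ 2)
  have hh : Differentiable ℂ h := by
    simp only [h]; fun_prop
  have hb : ∀ ζ, ‖ζ‖ ≤ r2 → ‖h ζ‖ < min θ (θ * d / 2) := fun ζ hζ => hM M le_rfl ζ hζ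
  refine ⟨h, hh, ?_, ?_, ?_⟩
  · simp only [h]; field_simp; simp
  · intro ζ hζ
    refine ⟨by simp [h, hPz ζ hζ], ?_⟩
    have e : h = fun ζ => ((ζ / c) ^ M / P c ^ 2 * P ζ) * P ζ := by
      funext ζ; simp only [h]; ring
    have h1 : DifferentiableAt ℂ (fun ζ => (ζ / c) ^ M / P c ^ 2 * P ζ) ζ := by fun_prop
    have h2 := (h1.hasDerivAt.mul (hP ζ).hasDerivAt).deriv
    rw [e]
    refine h2.trans ?_
    rw [hPz ζ hζ]; simp
  · intro ζ hζ
    refine ⟨(hb ζ (by simp only [r2]; linarith)).le.trans (min_le_left _ _), ?_⟩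
    have := Complex.norm_deriv_le_of_forall_mem_sphere_norm_le (c := ζ) (C := θ * d / 2) hd hh.diffContOnCl (by
      intro z hz
      have hz1 : ‖z - ζ‖ = d := by rw [← dist_eq_norm]; exact hz
      have hz2 : ‖z‖ ≤ ‖z - ζ‖ + ‖ζ‖ := by simpa using norm_add_le (z - ζ) ζ
      exact (hb z (by simp only [r2, d] at *; linarith)).le.trans (min_le_right _ _))
    refine this.trans ?_
    have e : θ * d / 2 / d = θ / 2 := by field_simp
    rw [e]; linarith

theorem rem_lip {n : ℕ} {ρ θ : ℝ} (hρ : 0 < ρ) (hρ' : ρ ≤ 1/8) (hθ0 : 0 ≤ θ) (hθ1 : θ ≤ 1/256) (hθ2 : θ ≤ ρ/2)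
    (μ : Fin n → ℂ) (hμ : ‖μ‖ ≤ 4) (R0 : (Fin n → ℂ) → (Fin n → ℂ)) 
    (hR0 : ∀ u u', ‖u‖ ≤ 3*ρ → ‖u'‖ ≤ 3*ρ → ‖R0 u - R0 u'‖ ≤ 1/32 * ‖u - u'‖)
    (H : (Fin n → ℂ) → ℂ) (hH : ∀ u, ‖u‖ ≤ 6/5*ρ → ‖H u‖ ≤ θ)
    (hH' : ∀ u u', ‖u‖ ≤ 6/5*ρ → ‖u'‖ ≤ 6/5*ρ → ‖H u - H u'‖ ≤ 2*θ*‖u - u'‖)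
    (e : Fin n → ℂ) (he : ‖e‖ ≤ 1) (s s' u u' : Fin n → ℂ) (hs : ‖s‖ ≤ 3*ρ) (hs' : ‖s'‖ ≤ 3*ρ) 
    (hu : ‖u‖ ≤ 6/5*ρ) (hu' : ‖u'‖ ≤ 6/5*ρ) :
    ‖(R0 (u + H u • (s - e)) + μ * (H u • (s - e))) - (R0 (u' + H u' • (s' - e)) + μ * (H u' • (s' - e)))‖ 
      ≤ 1/8 * max ‖s - s'‖ ‖u - u'‖ := by
  have hse : ∀ s : Fin n → ℂ, ‖s‖ ≤ 3*ρ → ‖s - e‖ ≤ 2 := by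
    intro s hs; have := norm_sub_le s e; linarith
  have hx : ∀ u s : Fin n → ℂ, ‖u‖ ≤ 6/5*ρ → ‖s‖ ≤ 3*ρ → ‖u + H u • (s - e)‖ ≤ 3 * ρ := by
    intro u s hu hs
    have h1 : ‖H u • (s - e)‖ ≤ θ * 2 := by
      rw [norm_smul]; exact mul_le_mul (hH u hu) (hse s hs) (norm_nonneg _) hθ0
    have := norm_add_le u (H u • (s - e))
    linarith
  set d := max ‖s - s'‖ ‖u - u'‖ with hd
  have hd1 : ‖s - s'‖ ≤ d := le_max_left _ _
  have hd2 : ‖u - u'‖ ≤ d := le_max_right _ _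
  have hd0 : 0 ≤ d := (norm_nonneg _).trans hd1
  have hw : ‖H u • (s - e) - H u' • (s' - e)‖ ≤ 5 * θ * d := by
    have e1 : H u • (s - e) - H u' • (s' - e) = H u • (s - s') + (H u - H u') • (s' - e) := by
      module
    rw [e1]
    refine (norm_add_le _ _).trans ?_
    rw [norm_smul, norm_smul]
    have h1 : ‖H u‖ * ‖s - s'‖ ≤ θ * d := mul_le_mul (hH u hu) hd1 (norm_nonneg _) hθ0
    have h2 : ‖H u - H u'‖ * ‖s' - e‖ ≤ (2*θ*d) * 2 := by
      refine mul_le_mul ((hH' u u' hu hu').trans ?_) (hse s' hs') (norm_nonneg _) (by positivity)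
      exact mul_le_mul_of_nonneg_left hd2 (by positivity)
    linarith
  have h1 := hR0 _ _ (hx u s hu hs) (hx u' s' hu' hs')
  have h2 : ‖(u + H u • (s - e)) - (u' + H u' • (s' - e))‖ ≤ d + 5*θ*d := by
    have e1 : (u + H u • (s - e)) - (u' + H u' • (s' - e)) = (u - u') + (H u • (s - e) - H u' • (s' - e)) := by
      abel
    rw [e1]
    exact (norm_add_le _ _).trans (add_le_add hd2 hw)
  have h3 : ‖μ * (H u • (s - e) - H u' • (s' - e))‖ ≤ 4 * (5*θ*d) :=
    (norm_mul_le _ _).trans (mul_le_mul hμ hw (norm_nonneg _) (by norm_num))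
  have e1 : (R0 (u + H u • (s - e)) + μ * (H u • (s - e))) - (R0 (u' + H u' • (s' - e)) + μ * (H u' • (s' - e)))
    = (R0 (u + H u • (s - e)) - R0 (u' + H u' • (s' - e))) + μ * (H u • (s - e) - H u' • (s' - e)) := by
    rw [mul_sub]; abel
  rw [e1]
  refine (norm_add_le _ _).trans ?_
  have h4 : θ * d ≤ 1/256 * d := mul_le_mul_of_nonneg_right hθ1 hd0
  linarith

theorem stable2 {n : ℕ} {ρ θ : ℝ} (hρ : 0 < ρ) (hρ' : ρ ≤ 1/8) (hθ0 : 0 ≤ θ) (hθ1 : θ ≤ 1/256) (hθ2 : θ ≤ ρ/2)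
    (i0 i1 : Fin n) (κ : ℂ) (hκ : ‖κ‖ ≤ 2 * ρ) (μ : Fin n → ℂ) (hμ0 : ‖μ i0‖ ≤ 1/4)
    (hμ1 : ∀ i, i ≠ i0 → ‖μ i‖ = 4)
    (g : (Fin n → ℂ) → (Fin n → ℂ)) (hg0 : g 0 = 0)
    (hR0 : ∀ u u', ‖u‖ ≤ 3*ρ → ‖u'‖ ≤ 3*ρ → ‖(g u - μ * u) - (g u' - μ * u')‖ ≤ 1/32 * ‖u - u'‖)
    (H : (Fin n → ℂ) → ℂ) (hH : ∀ u, ‖u‖ ≤ 6/5*ρ → ‖H u‖ ≤ θ)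
    (hH' : ∀ u u', ‖u‖ ≤ 6/5*ρ → ‖u'‖ ≤ 6/5*ρ → ‖H u - H u'‖ ≤ 2*θ*‖u - u'‖) (hH0 : H 0 = 0)
    (e : Fin n → ℂ) (he : ‖e‖ ≤ 1) :
    ∃ w : ℕ → (Fin n → ℂ), ‖w 0‖ ≤ 3 * ρ ∧ w 0 i0 = κ * (1 - w 0 i1) ∧ w 1 = g (w 0) ∧ 
      (∀ k, w (k+2) = g (w (k+1) + H (w (k+1)) • (w 0 - e))) ∧ Tendsto w atTop (𝓝 0) := by
  have hμ4 : ‖μ‖ ≤ 4 := by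
    rw [pi_norm_le_iff_of_nonneg (by norm_num)]
    intro i
    by_cases hi : i = i0
    · rw [hi]; linarith
    · rw [hμ1 i hi]
  let R0 : (Fin n → ℂ) → (Fin n → ℂ) := fun u => g u - μ * u
  let R : ℕ → (Fin n → ℂ) → (Fin n → ℂ) → (Fin n → ℂ) := fun k s u => 
    if k = 0 then R0 u else R0 (u + H u • (s - e)) + μ * (H u • (s - e))
  obtain ⟨w, w1, w2, w3, w4⟩ := stable hρ i0 μ hμ0 (fun i hi => (hμ1 i hi).ge) R (by
    intro k s s' u u' hs hs' hu hu'
    simp only [R, Bnd] at *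
    split_ifs at * with hk
    · refine (hR0 u u' hu hu').trans ?_
      have := le_max_right ‖s - s'‖ ‖u - u'‖
      linarith [norm_nonneg (u - u')]
    · exact rem_lip hρ hρ' hθ0 hθ1 hθ2 μ hμ4 R0 hR0 H hH hH' e he s s' u u' hs hs' hu hu') (by
    intro k s hs
    simp only [R, R0, hH0, hg0]
    split_ifs <;> simp [hg0]) (fun s => κ * (1 - s i1)) (by
    intro s hs
    have h1 := norm_sub_le (1:ℂ) (s i1)
    have h2 := (norm_le_pi_norm s i1).trans hs
    rw [norm_one] at h1
    rw [norm_mul]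
    calc _ ≤ (2*ρ) * (1 + 3*ρ) := mul_le_mul hκ (by linarith) (norm_nonneg _) (by positivity)
      _ ≤ _ := by nlinarith) (by
    intro s s' hs hs'
    have e : κ * (1 - s i1) - κ * (1 - s' i1) = -(κ * ((s - s') i1)) := by
      rw [Pi.sub_apply]; ring
    simp only [e, norm_neg, norm_mul]
    exact mul_le_mul (by linarith) (norm_le_pi_norm _ _) (norm_nonneg _) (by norm_num))
  refine ⟨w, by simpa [Bnd] using w1 0, w2, ?_, ?_, w4⟩
  · rw [w3 0]; simp [R, R0]
  · intro k
    rw [w3 (k+1)]; simp only [R, R0]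
    rw [if_neg (by omega), mul_add]; abel

theorem final_step {n : ℕ} {f g0 : En n → En n} (hf : VAut f) (hg : VAut g0) {R R' ε : ℝ} (hR0 : 0 ≤ R) (hRR : R ≤ R')
    (hN : Near f R ε g0) (p : En n) (hp : g0 p = p) (i0 i1 : Fin n) (hi : i0 ≠ i1) (μ : Fin n → ℂ)
    (hμ0 : ‖μ i0‖ ≤ 1/4) (hμ1 : ∀ i, i ≠ i0 → ‖μ i‖ = 4) (hD : ∀ u i, fderiv ℂ g0 p u i = μ i * u i)
    (hb : R' < ‖p i0‖) (x : ℕ → En n) (N : ℕ) (hx : ∀ j < N, x (j+1) = g0 (x j)) 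
    (hxb : ∀ j < N, ‖x j i0‖ ≤ R') 
    (hxN : x N = p + (EuclideanSpace.equiv (Fin n) ℂ).symm (Pi.single i1 1)) :
    ∃ g, VAut g ∧ Near f R ε g ∧ g p = p ∧ fderiv ℂ g p = fderiv ℂ g0 p ∧ 
      Tendsto (fun k => g^[k] (x 0)) atTop (𝓝 p) := by
  classical
  let T : En n ≃L[ℂ] (Fin n → ℂ) := EuclideanSpace.equiv (Fin n) ℂ
  have hT : ∀ z i, T z i = z i := fun _ _ => rfl
  have hT' : ∀ z i, T.symm z i = z i := fun _ _ => rfl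
  have hxN' : x N = p + T.symm (Pi.single i1 1) := hxN
  clear hxN
  clear_value T
  -- the local map
  let gh : (Fin n → ℂ) → (Fin n → ℂ) := fun u => T (g0 (p + T.symm u)) - T p
  have gh0 : gh 0 = 0 := by simp [gh, hp]
  have ghs : ∀ u, p + T.symm (gh u) = g0 (p + T.symm u) := by
    intro u; simp [gh]
  have hstr : HasStrictFDerivAt gh ((T : En n →L[ℂ] (Fin n → ℂ)).comp ((fderiv ℂ g0 p).comp (T.symm : (Fin n → ℂ) →L[ℂ] En n))) 0 := by
    have h1 : HasStrictFDerivAt g0 (fderiv ℂ g0 p) p := 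
      (entire_contDiff hg.diff).contDiffAt.hasStrictFDerivAt (by norm_num)
    have h2 : HasStrictFDerivAt (fun u => p + T.symm u) (T.symm : (Fin n → ℂ) →L[ℂ] En n) 0 := 
      T.symm.hasStrictFDerivAt.const_add p
    have h3 : HasStrictFDerivAt g0 (fderiv ℂ g0 p) ((fun u => p + T.symm u) 0) := by
      have e : (fun u => p + T.symm u) 0 = p := by simp
      rw [e]; exact h1
    have h4 := h3.comp 0 h2
    exact (T.hasStrictFDerivAt.comp 0 h4).sub_const _
  clear_value gh
  obtain ⟨s, hs, hap⟩ := hstr.approximates_deriv_on_nhds (c := 1/32) (Or.inr (by norm_num))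
  obtain ⟨δ, hδ, hδs⟩ := Metric.mem_nhds_iff.mp hs
  have hlip : ∀ u ∈ ball (0 : Fin n → ℂ) δ, ∀ u' ∈ ball (0 : Fin n → ℂ) δ, 
      ‖(gh u - μ * u) - (gh u' - μ * u')‖ ≤ 1/32 * ‖u - u'‖ := by
    intro u hu u' hu'
    have h1 := hap u (hδs hu) u' (hδs hu')
    have e : (gh u - μ * u) - (gh u' - μ * u') = gh u - gh u' - 
      ((T : En n →L[ℂ] (Fin n → ℂ)).comp ((fderiv ℂ g0 p).comp (T.symm : (Fin n → ℂ) →L[ℂ] En n))) (u - u') := by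
      funext i
      have : ((T : En n →L[ℂ] (Fin n → ℂ)).comp ((fderiv ℂ g0 p).comp (T.symm : (Fin n → ℂ) →L[ℂ] En n))) (u - u') i = μ i * (u i - u' i) := by
        change T (fderiv ℂ g0 p (T.symm (u - u'))) i = _
        rw [hT, hD, hT', Pi.sub_apply]
      simp only [Pi.sub_apply, Pi.mul_apply, this]
      ring
    rw [e]
    exact h1
  -- constants
  obtain ⟨C, hC0, hC1, hC2⟩ : ∃ C : ℝ, 0 ≤ C ∧ (∀ j < N, ‖x j i1 - p i1‖ ≤ C) ∧ R + ‖p i1‖ ≤ C := by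
    refine ⟨(∑ j ∈ Finset.range N, ‖x j i1 - p i1‖) + (|R| + ‖p i1‖), by positivity, ?_, ?_⟩
    · intro j hj
      have := Finset.single_le_sum (f := fun j => ‖x j i1 - p i1‖) (fun j _ => norm_nonneg _) (Finset.mem_range.mpr hj)
      have h2 : 0 ≤ |R| + ‖p i1‖ := by positivity
      simp only at this
      linarith
    · have : 0 ≤ ∑ j ∈ Finset.range N, ‖x j i1 - p i1‖ := Finset.sum_nonneg fun _ _ => norm_nonneg _
      linarith [le_abs_self R]
  obtain ⟨ρ, hρ, hρ1, hρ2, hρ3⟩ : ∃ ρ : ℝ, 0 < ρ ∧ ρ ≤ 1/8 ∧ 3 * ρ < δ ∧ 2 * ρ * C ≤ ‖p i0‖ - R' := by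
    refine ⟨min (1/8) (min (δ/4) ((‖p i0‖ - R') / (2 * (C + 1)))), ?_, min_le_left _ _, ?_, ?_⟩
    · have : 0 < ‖p i0‖ - R' := by linarith
      positivity
    · have := (min_le_right (1/8) (min (δ/4) ((‖p i0‖ - R') / (2 * (C + 1))))).trans (min_le_left _ _)
      linarith
    · have := (min_le_right (1/8) (min (δ/4) ((‖p i0‖ - R') / (2 * (C + 1))))).trans (min_le_right _ _)
      have h0 : 0 < ‖p i0‖ - R' := by linarith
      calc _ ≤ 2 * ((‖p i0‖ - R') / (2 * (C + 1))) * C := by gcongr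
        _ = (‖p i0‖ - R') * (C / (C+1)) := by field_simp
        _ ≤ (‖p i0‖ - R') * 1 := by
          refine mul_le_mul_of_nonneg_left ?_ h0.le
          rw [div_le_one (by positivity)]; linarith
        _ = _ := mul_one _
  obtain ⟨b, hbdef⟩ : ∃ b, b = p i0 := ⟨_, rfl⟩
  rw [← hbdef] at hb hρ3
  have hb0 : 0 < ‖b‖ := by linarith
  obtain ⟨κ, hκ, hc⟩ : ∃ κ : ℂ, ‖κ‖ = 2 * ρ ∧ ‖b + κ‖ = ‖b‖ + 2 * ρ := by
    refine ⟨((2 * ρ / ‖b‖ : ℝ) : ℂ) * b, ?_, ?_⟩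
    · rw [norm_mul, Complex.norm_real, Real.norm_of_nonneg (by positivity)]; field_simp
    · have : b + ((2 * ρ / ‖b‖ : ℝ) : ℂ) * b = ((1 + 2 * ρ / ‖b‖ : ℝ) : ℂ) * b := by push_cast; ring
      rw [this, norm_mul, Complex.norm_real, Real.norm_of_nonneg (by positivity)]; field_simp
  let L : En n →L[ℂ] ℂ := EuclideanSpace.proj i0 + κ • EuclideanSpace.proj i1
  have hL : ∀ z, L z = z i0 + κ * z i1 := fun z => rfl
  clear_value L
  obtain ⟨a, ha⟩ : ∃ a, a = κ * p i1 := ⟨_, rfl⟩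
  have hLb : ∀ z r, ‖z i0‖ ≤ R' → ‖z i1 - p i1‖ ≤ C → r = L z - a → ‖r‖ ≤ ‖b‖ := by
    rintro z r h1 h2 rfl
    have e : L z - a = z i0 + κ * (z i1 - p i1) := by rw [hL, ha]; ring
    rw [e]
    refine (norm_add_le _ _).trans ?_
    rw [norm_mul, hκ]
    have : 2 * ρ * ‖z i1 - p i1‖ ≤ 2 * ρ * C := by gcongr
    linarith
  obtain ⟨η, hη, hpert⟩ := Near.perturb hf.diff.continuous hg.diff.continuous hN
  let S := ‖(T.symm : (Fin n → ℂ) →L[ℂ] En n)‖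
  have hS0 : 0 ≤ S := norm_nonneg _
  obtain ⟨θ, hθ, hθ1, hθ2, hθ3⟩ : ∃ θ : ℝ, 0 < θ ∧ θ ≤ 1/256 ∧ θ ≤ ρ/2 ∧ θ * (S * 2) < η := by
    refine ⟨min (1/256) (min (ρ/2) (η / (2 * (S+1)))), by positivity, min_le_left _ _, 
      (min_le_right _ _).trans (min_le_left _ _), ?_⟩
    have := (min_le_right (1/256) (min (ρ/2) (η / (2 * (S+1))))).trans (min_le_right _ _)
    calc _ ≤ (η / (2 * (S+1))) * (S * 2) := by gcongr
      _ = η * (S / (S+1)) := by field_simp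
      _ < η * 1 := by
        refine mul_lt_mul_of_pos_left ?_ hη
        rw [div_lt_one (by positivity)]; linarith
      _ = _ := mul_one _
  obtain ⟨h, hh, hhc, hhZ, hhb⟩ := bump (b + κ) (‖b‖ + 3/2*ρ) (by positivity) (by rw [hc]; linarith) 
    (insert b ((Finset.range N).image fun j => L (x j) - a)) (by
      intro hm
      rcases Finset.mem_insert.mp hm with hm | hm
      · rw [hm] at hc; linarith
      · obtain ⟨j, hj, e⟩ := Finset.mem_image.mp hm
        have hj := Finset.mem_range.mp hj
        have := hLb (x j) _ (hxb j hj) (hC1 j hj) e.symm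
        rw [hc] at this; linarith) hθ
  have hhb' := hhZ b (Finset.mem_insert_self _ _)
  let H : (Fin n → ℂ) → ℂ := fun u => h (b + (u i0 + κ * u i1))
  have hHd : ∀ u : Fin n → ℂ, ‖u i0 + κ * u i1‖ ≤ (1 + 2 * ρ) * ‖u‖ := by
    intro u
    refine (norm_add_le _ _).trans ?_
    rw [norm_mul, hκ]
    have := norm_le_pi_norm u i0
    have : 2 * ρ * ‖u i1‖ ≤ 2 * ρ * ‖u‖ := by gcongr; exact norm_le_pi_norm u i1
    linarith
  have hHdom : ∀ u : Fin n → ℂ, ‖u‖ ≤ 6/5*ρ → b + (u i0 + κ * u i1) ∈ closedBall (0:ℂ) (‖b‖ + 3/2*ρ) := by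
    intro u hu
    rw [mem_closedBall_zero_iff]
    refine (norm_add_le _ _).trans ?_
    have h1 : (1 + 2 * ρ) * ‖u‖ ≤ (1 + 2 * (1/8)) * (6/5*ρ) := by gcongr
    have := hHd u
    linarith
  obtain ⟨w, w0, w1, w2, w3, w4⟩ := stable2 hρ hρ1 hθ.le hθ1 hθ2 i0 i1 κ hκ.le μ hμ0 hμ1 gh gh0 
    (fun u u' hu hu' => hlip u (by rw [mem_ball_zero_iff]; linarith) u' (by rw [mem_ball_zero_iff]; linarith))
    H (fun u hu => (hhb _ (by simpa using hHdom u hu)).1) (by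
      intro u u' hu hu'
      have := (convex_closedBall (0:ℂ) (‖b‖ + 3/2*ρ)).norm_image_sub_le_of_norm_deriv_le (f := h) (C := θ)
        (fun z _ => hh z) (fun z hz => (hhb z (by simpa using hz)).2) (hHdom u' hu') (hHdom u hu)
      refine this.trans ?_
      have e : b + (u i0 + κ * u i1) - (b + (u' i0 + κ * u' i1)) = (u - u') i0 + κ * (u - u') i1 := by
        simp only [Pi.sub_apply]; ring
      rw [e]
      have h1 := hHd (u - u')
      have h2 : (1 + 2 * ρ) * ‖u - u'‖ ≤ 2 * ‖u - u'‖ := by gcongr; linarith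
      have h3 : θ * ‖(u - u') i0 + κ * (u - u') i1‖ ≤ θ * (2 * ‖u - u'‖) := by gcongr; exact h1.trans h2
      linarith) (by simp only [H, Pi.zero_apply, mul_zero, add_zero]; exact hhb'.1)
    (Pi.single i1 1) (by
      rw [pi_norm_le_iff_of_nonneg (by norm_num)]
      intro i
      by_cases h : i = i1
      · subst h; simp
      · simp [h])
  let v : En n := T.symm (w 0 - Pi.single i1 1)
  have hLv : L v = 0 := by
    rw [hL]; simp only [v, hT', Pi.sub_apply, Pi.single_eq_same, Pi.single_eq_of_ne hi]
    rw [w1]; ring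
  have hvn : ‖v‖ ≤ S * 2 := by
    refine ((T.symm : (Fin n → ℂ) →L[ℂ] En n).le_opNorm _).trans ?_
    refine mul_le_mul_of_nonneg_left ?_ hS0
    refine (norm_sub_le _ _).trans ?_
    have : ‖(Pi.single i1 1 : Fin n → ℂ)‖ ≤ 1 := by
      rw [pi_norm_le_iff_of_nonneg (by norm_num)]
      intro i
      by_cases h : i = i1
      · subst h; simp
      · simp [h]
    linarith
  let h2 : ℂ → ℂ := fun ζ => h (ζ - a)
  have hh2 : Differentiable ℂ h2 := by simp only [h2]; fun_prop
  have hψ := shear_VAut L v hLv hh2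
  let ψ : En n → En n := fun z => z + h2 (L z) • v
  have hψ' : VAut ψ := hψ
  have hLp : L p - a = b := by rw [hL, ha, hbdef]; ring
  have ψp : ψ p = p := by simp only [ψ, h2, hLp, hhb'.1, zero_smul, add_zero]
  have ψu : ∀ u : Fin n → ℂ, ψ (p + T.symm u) = p + T.symm (u + H u • (w 0 - Pi.single i1 1)) := by
    intro u
    have : L (p + T.symm u) - a = b + (u i0 + κ * u i1) := by
      rw [map_add, add_sub_right_comm, hLp, hL, hT', hT']
    simp only [ψ, h2, this, H, v]
    rw [map_add, map_smul, add_assoc]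
  have ψj : ∀ j < N, ψ (x j) = x j := by
    intro j hj
    have := (hhZ _ (Finset.mem_insert_of_mem (Finset.mem_image_of_mem (fun j => L (x j) - a) (Finset.mem_range.mpr hj)))).1
    simp only [ψ, h2, this, zero_smul, add_zero]
  have ψN : ψ (x N) = p + T.symm (w 0) := by
    have h1 : L (x N) - a = b + κ := by
      rw [hxN', map_add, add_sub_right_comm, hLp, hL, hT', hT']
      simp [hi]
    simp only [ψ, h2, h1, hhc, one_smul, v]
    rw [hxN', map_sub]; abel
  clear_value H
  have hit : ∀ j ≤ N, (g0 ∘ ψ)^[j] (x 0) = x j := by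
    intro j
    induction j with
    | zero => intro _; rfl
    | succ j ih =>
      intro hj
      rw [iterate_succ_apply', ih (by omega), comp_apply, ψj j (by omega), hx j (by omega)]
  have hit2 : ∀ k, (g0 ∘ ψ)^[k + (N+1)] (x 0) = p + T.symm (w (k+1)) := by
    intro k
    induction k with
    | zero => 
      rw [zero_add, iterate_succ_apply', hit N le_rfl, comp_apply, ψN, ← ghs, w2]
    | succ k ih =>
      rw [show k + 1 + (N+1) = (k + (N+1)) + 1 by ring, iterate_succ_apply', ih, comp_apply, ψu, ← ghs, ← w3]
  refine ⟨g0 ∘ ψ, hg.comp hψ', hpert ψ ?_, by rw [comp_apply, ψp, hp], ?_, ?_⟩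
  · intro z hz
    rw [mem_closedBall_zero_iff] at hz
    have hz0 : ‖z i0‖ ≤ ‖z‖ := PiLp.norm_apply_le z i0
    have hz1 : ‖z i1‖ ≤ ‖z‖ := PiLp.norm_apply_le z i1
    have h3 := hLb z _ (by linarith) ((norm_sub_le _ _).trans (by linarith)) rfl
    have h4 := (hhb (L z - a) (by linarith)).1
    rw [dist_eq_norm]
    simp only [ψ, h2, add_sub_cancel_left]
    rw [norm_smul]
    refine lt_of_le_of_lt ?_ hθ3
    gcongr
  · have h3 : HasFDerivAt ψ (ContinuousLinearMap.id ℂ (En n) + deriv h2 (L p) • L.smulRight v) p := 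
      shear_hasFDerivAt L v hh2 p
    have h4 : deriv h2 (L p) = 0 := by
      have : deriv h2 (L p) = deriv h (L p - a) := deriv_comp_sub_const h a (L p)
      rw [this, hLp, hhb'.2]
    have h7 : ContinuousLinearMap.id ℂ (En n) + deriv h2 (L p) • L.smulRight v = ContinuousLinearMap.id ℂ (En n) := by
      ext1 z; rw [h4]; simp
    rw [h7] at h3
    have h5 : HasFDerivAt g0 (fderiv ℂ g0 p) (ψ p) := by rw [ψp]; exact (hg.diff p).hasFDerivAt
    have h6 := (h5.comp p h3).fderiv
    rw [h6, ContinuousLinearMap.comp_id]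
  · rw [← tendsto_add_atTop_iff_nat (N+1)]
    simp only [hit2]
    have h3 : Tendsto (fun k => w (k+1)) atTop (𝓝 0) := (tendsto_add_atTop_iff_nat 1).mpr w4
    have h4 : Continuous fun u => p + T.symm u := by fun_prop
    have h5 := (h4.tendsto 0).comp h3
    simp only [map_zero, add_zero] at h5
    exact h5

theorem core {n : ℕ} (hn : 2 ≤ n) {f : En n → En n} (hf : VAut f) {R ε : ℝ} (hR : 0 ≤ R) (hε : 0 < ε) 
    (q : En n) {r : ℝ} (hr : 0 < r) :
    ∃ g, VAut g ∧ Near f R ε g ∧ ∃ p, HypFixedPt g p ∧ ∃ x ∈ ball q r, Tendsto (fun k => g^[k] x) atTop (𝓝 p) := by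
  classical
  have hnt : Nontrivial (Fin n) := Fin.nontrivial_iff_two_le.mpr hn
  let T : En n ≃L[ℂ] (Fin n → ℂ) := EuclideanSpace.equiv (Fin n) ℂ
  have hT : ∀ z i, T z i = z i := fun _ _ => rfl
  have hT' : ∀ z i, T.symm z i = z i := fun _ _ => rfl
  have hTdef : T = EuclideanSpace.equiv (Fin n) ℂ := rfl
  clear_value T
  obtain ⟨C0, hC0, hfC⟩ := bdd_ball hf.diff.continuous (0 : En n) R
  obtain ⟨R', hRR, hRC⟩ : ∃ R', R ≤ R' ∧ C0 + ε ≤ R' := ⟨max R (C0 + ε), le_max_left _ _, le_max_right _ _⟩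
  have hR' : 0 ≤ R' := hR.trans hRR
  let S := ‖(T.symm : (Fin n → ℂ) →L[ℂ] En n)‖
  obtain ⟨G, hG, hGN, x0, hx0, N0, hN0⟩ := escape hn hf R ε hε q r hr (S * R')
  obtain ⟨N, ⟨i0, hi0⟩, hmin⟩ := min_ex (P := fun m => ∃ i, R' < ‖(G^[m] x0) i‖) (by
    refine ⟨N0, ?_⟩
    by_contra hcon
    push Not at hcon
    have h1 : ‖T (G^[N0] x0)‖ ≤ R' := by
      rw [pi_norm_le_iff_of_nonneg hR']
      intro i; rw [hT]; exact hcon i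
    have h2 := (T.symm : (Fin n → ℂ) →L[ℂ] En n).le_opNorm (T (G^[N0] x0))
    have h3 : (T.symm : (Fin n → ℂ) →L[ℂ] En n) (T (G^[N0] x0)) = G^[N0] x0 := T.symm_apply_apply _
    rw [h3] at h2
    have h4 : S * ‖T (G^[N0] x0)‖ ≤ S * R' := mul_le_mul_of_nonneg_left h1 (norm_nonneg _)
    exact absurd (h2.trans h4) (not_le.mpr hN0))
  obtain ⟨x, hxdef⟩ : ∃ x : ℕ → En n, ∀ j, x j = G^[j] x0 := ⟨_, fun _ => rfl⟩
  have hxs : ∀ j, x (j+1) = G (x j) := by intro j; rw [hxdef, hxdef, iterate_succ_apply']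
  have hxb : ∀ j < N, ∀ i, ‖x j i‖ ≤ R' := by
    intro j hj i
    have := hmin j hj
    push Not at this
    rw [hxdef]; exact this i
  rw [← hxdef] at hi0
  obtain ⟨i1, hi1⟩ := exists_ne i0
  let e : En n := T.symm (Pi.single i1 1)
  have he1 : e i1 = 1 := by simp only [e, hT']; simp
  have he0 : e i0 = 0 := by simp only [e, hT']; simp [hi1.symm]
  obtain ⟨p, hpdef⟩ : ∃ p, p = x N - e := ⟨_, rfl⟩
  have hpx : x N = p + e := by rw [hpdef]; abel
  have hp0 : p i0 = x N i0 := by rw [hpdef, PiLp.sub_apply, he0, sub_zero]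
  have hpb : R' < ‖p i0‖ := by rw [hp0]; exact hi0
  have hpn : R' < ‖p‖ := hpb.trans_le (PiLp.norm_apply_le p i0)
  obtain ⟨Gi, hGi, hl, hrr⟩ := hG.exists_inv
  have hGp : G (Gi p) = p := hrr p
  have hps : R < ‖Gi p‖ := by
    by_contra hcon
    push Not at hcon
    have hm : Gi p ∈ closedBall (0 : En n) R := by rw [mem_closedBall_zero_iff]; exact hcon
    have h1 := hGN _ hm
    have h2 := hfC _ hm
    rw [hGp, dist_eq_norm] at h1
    have h3 : ‖p‖ ≤ ‖p - f (Gi p)‖ + ‖f (Gi p)‖ := by simpa using norm_add_le (p - f (Gi p)) (f (Gi p))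
    linarith
  let F : Finset (En n) := (Finset.range N).image x
  have hF : ∀ y ∈ F, ∃ j < N, x j = y := by
    intro y hy
    obtain ⟨j, hj, h⟩ := Finset.mem_image.mp hy
    exact ⟨j, Finset.mem_range.mp hj, h⟩
  have hpF : p ∉ F := by
    intro h
    obtain ⟨j, hj, h⟩ := hF _ h
    have := hxb j hj i0
    rw [h] at this; linarith
  have hpsF : Gi p ∉ F := by
    intro h
    obtain ⟨j, hj, h⟩ := hF _ h
    have h1 : x (j+1) = p := by rw [hxs, h, hGp]
    rcases Nat.lt_or_ge (j+1) N with h2 | h2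
    · have := hxb _ h2 i0
      rw [h1] at this; linarith
    · have h3 : j + 1 = N := by omega
      rw [h3, hpx] at h1
      have h4 : e = 0 := by simpa using h1
      rw [h4] at he1; simp at he1
  obtain ⟨G1, hG1, hN1, hG1F, hG1p⟩ := move hn hf hG hR hGN F p (Gi p) (by linarith) hps hpF hpsF
  rw [hGp] at hG1p
  obtain ⟨Gj, hGj, hl1, hr1⟩ := hG1.exists_inv
  have hGjp : Gj p = p := by rw [← hG1p]; rw [hl1 p, hG1p]
  have hcomp : (fderiv ℂ G1 p).comp (fderiv ℂ Gj p) = ContinuousLinearMap.id ℂ (En n) := by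
    have h1 : G1 ∘ Gj = id := funext hr1
    have h2 := fderiv_comp p (hG1.diff (Gj p)) (hGj.diff p)
    rw [h1, fderiv_id, hGjp] at h2
    exact h2.symm
  let μ : Fin n → ℂ := Function.update (fun _ => 4) i0 ((1/4)^(n-1))
  have hμ0 : ‖μ i0‖ ≤ 1/4 := by
    simp only [μ, Function.update_self, norm_pow]
    have : ‖(1/4 : ℂ)‖ = 1/4 := by norm_num
    rw [this]
    exact pow_le_of_le_one (by norm_num) (by norm_num) (by omega)
  have hμ1 : ∀ i, i ≠ i0 → ‖μ i‖ = 4 := by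
    intro i hi
    simp only [μ, Function.update_of_ne hi]; norm_num
  have hμp : ∏ i, μ i = 1 := by
    simp only [μ]
    rw [Finset.prod_update_of_mem (Finset.mem_univ i0), Finset.prod_const, Finset.card_sdiff_of_subset (by simp)]
    simp [← mul_pow]
  clear_value μ
  let Λ0 : En n →ₗ[ℂ] En n := T.symm.toLinearEquiv.toLinearMap ∘ₗ Matrix.toLin' (Matrix.diagonal μ) ∘ₗ T.symm.toLinearEquiv.symm.toLinearMap
  let Λ : En n →L[ℂ] En n := LinearMap.toContinuousLinearMap Λ0
  have hΛ : ∀ u i, Λ u i = μ i * u i := by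
    intro u i
    change (T.symm (Matrix.toLin' (Matrix.diagonal μ) (T u))) i = _
    rw [hT', Matrix.toLin'_apply, Matrix.mulVec_diagonal, hT]
  have hΛd : Λ.det = 1 := by
    have : LinearMap.det Λ0 = 1 := by
      simp only [Λ0]
      rw [LinearMap.det_conj, LinearMap.det_toLin', Matrix.det_diagonal, hμp]
    exact this
  clear_value Λ
  obtain ⟨g0, hg0, hN2, hg0F, hg0p, hg0D⟩ := set_deriv hn hf hR F p (by linarith) hpF ((fderiv ℂ Gj p).comp Λ) (by
    have h1 := hGj.2 p
    have h2 : ((fderiv ℂ Gj p).comp Λ).det = (fderiv ℂ Gj p).det * Λ.det := LinearMap.det_comp _ _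
    rw [h2, h1, hΛd, mul_one]) hG1 hN1
  rw [← ContinuousLinearMap.comp_assoc, hcomp, ContinuousLinearMap.id_comp] at hg0D
  rw [hG1p] at hg0p
  obtain ⟨g, hg, hgN, hgp, hgD, hgt⟩ := final_step hf hg0 hR hRR hN2 p hg0p i0 i1 hi1.symm μ hμ0 hμ1 
    (by rw [hg0D]; exact hΛ) hpb x N (by
      intro j hj
      have hm : x j ∈ F := Finset.mem_image_of_mem _ (Finset.mem_range.mpr hj)
      rw [hg0F _ hm, hG1F _ hm, hxs]) (fun j hj => hxb j hj i0) (by rw [← hTdef]; exact hpx)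
  refine ⟨g, hg, hgN, p, ⟨hgp, ?_⟩, x0, hx0, ?_⟩
  · intro ν hν
    rw [hgD, hg0D] at hν
    obtain ⟨u, hu⟩ := hν.exists_hasEigenvector
    have h1 : Λ u = ν • u := hu.apply_eq_smul
    obtain ⟨i, hi⟩ : ∃ i, u i ≠ 0 := by
      by_contra hcon
      push Not at hcon
      apply hu.2
      ext i; simpa using hcon i
    have h2 := hΛ u i
    rw [h1, PiLp.smul_apply, smul_eq_mul] at h2
    have h3 : ν = μ i := mul_right_cancel₀ hi h2
    rw [h3]
    by_cases hii : i = i0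
    · rw [hii]; intro h; rw [h] at hμ0; norm_num at hμ0
    · rw [hμ1 i hii]; norm_num
  · have : x 0 = x0 := by rw [hxdef]; rfl
    rw [this] at hgt
    exact hgt

/-- For n ≥ 2, q ∈ ℂⁿ and ε > 0, the set of f ∈ Aut_{ω₀}(ℂⁿ) having a hyperbolic
fixed point whose stable manifold meets the open ball B(q, ε) is dense in Aut_{ω₀}(ℂⁿ). -/
theorem stmt_14 (n : ℕ) (hn : 2 ≤ n) (q : En n) (ε : ℝ) (hε : 0 < ε) :
    Dense {f : ↥(AutOmega n) | ∃ p : En n, HypFixedPt ⇑f.1 p ∧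
      (StableSet ⇑f.1 p ∩ Metric.ball q ε).Nonempty} := by
  intro f
  have hf : VAut f.1 := f.2
  have key : ∀ k : ℕ, ∃ g : ↥(AutOmega n), (∃ p : En n, HypFixedPt ⇑g.1 p ∧
      (StableSet ⇑g.1 p ∩ Metric.ball q ε).Nonempty) ∧ Near f.1 k (1/((k:ℝ)+1)) g.1 := by
    intro k
    obtain ⟨g, hg, hgN, p, hp, x, hx, hxt⟩ := core hn hf (R := k) (ε := 1/((k:ℝ)+1)) (by positivity) (by positivity) q hε
    exact ⟨⟨⟨g, hg.diff.continuous⟩, hg⟩, ⟨p, hp, x, hxt, hx⟩, hgN⟩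
  choose g hg1 hg2 using key
  refine mem_closure_of_tendsto (f := g) (b := atTop) ?_ (Eventually.of_forall hg1)
  rw [tendsto_subtype_rng, ContinuousMap.tendsto_iff_forall_isCompact_tendstoUniformlyOn]
  intro K hK
  rw [Metric.tendstoUniformlyOn_iff]
  intro δ hδ
  obtain ⟨r, hr⟩ := hK.isBounded.subset_closedBall (0 : En n)
  have h1 : ∀ᶠ k : ℕ in atTop, 1/((k:ℝ)+1) < δ := 
    (tendsto_one_div_add_atTop_nhds_zero_nat (𝕜 := ℝ)).eventually_lt_const hδ
  have h2 : ∀ᶠ k : ℕ in atTop, r ≤ (k:ℝ) := tendsto_natCast_atTop_atTop.eventually_ge_atTop r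
  filter_upwards [h1, h2] with k hk1 hk2 z hz
  rw [dist_comm]
  exact (hg2 k z (closedBall_subset_closedBall hk2 (hr hz))).trans hk1
end
end

section
/- Let A ⊂ ℂⁿ be a bounded open set, let f : A → A be a holomorphic map, and let p ∈ A be a fixed point of f. Then every eigenvalue of the complex derivative Df(p) has modulus at most 1. -/
open Topology Filter Metric Set Function

noncomputable section

/-- If A ⊂ ℂⁿ is bounded open, f : A → A is holomorphic and p ∈ A is a fixed
point of f, then every eigenvalue of Df(p) has modulus at most 1. -/
theorem stmt_16 (n : ℕ) (A : Set (En n)) (hAo : IsOpen A) (hAb : Bornology.IsBounded A)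
    (f : En n → En n) (hf : DifferentiableOn ℂ f A) (hmap : Set.MapsTo f A A)
    (p : En n) (hp : p ∈ A) (hfix : f p = p)
    (μ : ℂ) (hμ : Module.End.HasEigenvalue
      ((fderiv ℂ f p : En n →ₗ[ℂ] En n) : Module.End ℂ (En n)) μ) :
    ‖μ‖ ≤ 1 := by
  obtain ⟨v, hv⟩ := hμ.exists_hasEigenvector
  have hv0 : v ≠ 0 := hv.2
  have hfp : DifferentiableAt ℂ f p := hf.differentiableAt (hAo.mem_nhds hp)
  obtain ⟨r, hr, hrA⟩ := Metric.isOpen_iff.1 hAo p hp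
  obtain ⟨R, hR, hAR⟩ := hAb.subset_ball_lt 0 p
  have hit : ∀ k : ℕ, DifferentiableOn ℂ (f^[k]) A := fun k => hf.iterate hmap k
  have hder : ∀ k : ℕ, HasFDerivAt (f^[k]) ((fderiv ℂ f p) ^ k) p :=
    fun k => hfp.hasFDerivAt.iterate hfix k
  have hev : ∀ k : ℕ, ((fderiv ℂ f p) ^ k) v = μ ^ k • v := by
    intro k
    induction k with
    | zero => simp
    | succ k ih =>
      have h1 : (fderiv ℂ f p) v = μ • v := hv.apply_eq_smul
      rw [pow_succ, ContinuousLinearMap.mul_apply, h1, map_smul, ih, smul_smul, pow_succ, mul_comm]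
  have hb : ∀ k : ℕ, ‖μ‖ ^ k ≤ R / r := by
    intro k
    have hpk : f^[k] p = p := Function.iterate_fixed hfix k
    have h := Complex.norm_fderiv_le_div_of_mapsTo_ball (f := f^[k]) (c := p) (R₁ := r) (R₂ := R)
      ((hit k).mono hrA) (by
        rw [hpk]
        exact fun x hx => ball_subset_closedBall (hAR (hmap.iterate k (hrA hx)))) hr
    rw [(hder k).fderiv] at h
    have h2 := ((fderiv ℂ f p) ^ k).le_of_opNorm_le h v
    rw [hev, norm_smul, norm_pow] at h2
    exact le_of_mul_le_mul_right h2 (norm_pos_iff.2 hv0)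
  by_contra! hlt
  obtain ⟨k, hk⟩ := pow_unbounded_of_one_lt (R / r) hlt
  exact absurd (hb k) (not_le.2 hk)
end
end

section
/- Let A ⊂ ℂⁿ be a bounded open set, let f : A → A be a holomorphic map, and let p ∈ A be a fixed point of f such that |det Df(p)| = 1. Then every eigenvalue of Df(p) has modulus exactly 1. -/
open Topology Filter Metric Set Function

noncomputable section

theorem aux_prod (t : Multiset ℂ) (h : ∀ z ∈ t, ‖z‖ ≤ 1) : ‖t.prod‖ ≤ 1 := by
  induction t using Multiset.induction with
  | empty => simp
  | cons a s ih =>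
    rw [Multiset.prod_cons, norm_mul]
    exact mul_le_one₀ (h a (Multiset.mem_cons_self a s)) (norm_nonneg _)
      (ih fun z hz => h z (Multiset.mem_cons_of_mem hz))

/-- If A ⊂ ℂⁿ is bounded open, f : A → A is holomorphic, p ∈ A is a fixed point
of f and |det Df(p)| = 1, then every eigenvalue of Df(p) has modulus exactly 1. -/
theorem stmt_17 (n : ℕ) (A : Set (En n)) (hAo : IsOpen A) (hAb : Bornology.IsBounded A)
    (f : En n → En n) (hf : DifferentiableOn ℂ f A) (hmap : Set.MapsTo f A A)
    (p : En n) (hp : p ∈ A) (hfix : f p = p)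
    (hdet : ‖(fderiv ℂ f p).det‖ = 1)
    (μ : ℂ) (hμ : Module.End.HasEigenvalue
      ((fderiv ℂ f p : En n →ₗ[ℂ] En n) : Module.End ℂ (En n)) μ) :
    ‖μ‖ = 1 := by
  have hd : HasFDerivAt f (fderiv ℂ f p) p :=
    (hf.differentiableAt (hAo.mem_nhds hp)).hasFDerivAt
  obtain ⟨r, hr, hrA⟩ := Metric.isOpen_iff.1 hAo p hp
  obtain ⟨R, hR⟩ := hAb.subset_closedBall p
  have hbd : ∀ k : ℕ, ‖(fderiv ℂ f p) ^ k‖ ≤ R / r := by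
    intro k
    have hk := (hd.iterate hfix k).fderiv
    have hfk : f^[k] p = p := Function.iterate_fixed hfix k
    rw [← hk]
    refine Complex.norm_fderiv_le_div_of_mapsTo_ball ((hf.iterate hmap k).mono hrA) ?_ hr
    intro x hx
    rw [hfk]
    exact hR (hmap.iterate k (hrA hx))
  have hle : ∀ z : ℂ, Module.End.HasEigenvalue
      ((fderiv ℂ f p : En n →ₗ[ℂ] En n) : Module.End ℂ (En n)) z → ‖z‖ ≤ 1 := by
    intro z hz
    obtain ⟨v, hv⟩ := hz.exists_hasEigenvector
    have hv0 : 0 < ‖v‖ := norm_pos_iff.2 hv.2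
    have hLv : (fderiv ℂ f p) v = z • v := hv.apply_eq_smul
    have hpow : ∀ k : ℕ, ((fderiv ℂ f p) ^ k) v = z ^ k • v := by
      intro k
      induction k with
      | zero => simp
      | succ k ih =>
        rw [pow_succ, ContinuousLinearMap.mul_apply, hLv, map_smul, ih, smul_smul, pow_succ']
    by_contra! hgt
    obtain ⟨k, hk⟩ := pow_unbounded_of_one_lt (R / r) hgt
    have h1 := ((fderiv ℂ f p) ^ k).le_opNorm v
    rw [hpow k, norm_smul, norm_pow] at h1
    have h2 := le_of_mul_le_mul_right h1 hv0
    linarith [hbd k]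
  set L : Module.End ℂ (En n) := ((fderiv ℂ f p : En n →ₗ[ℂ] En n) : Module.End ℂ (En n)) with hL
  have hdet' : ‖L.charpoly.roots.prod‖ = 1 := by
    rw [← Module.End.det_eq_prod_roots_charpoly_of_splits (IsAlgClosed.splits _)]
    exact hdet
  have hne : L.charpoly ≠ 0 := (LinearMap.charpoly_monic L).ne_zero
  have hmem : μ ∈ L.charpoly.roots :=
    (Polynomial.mem_roots hne).2 ((Module.End.hasEigenvalue_iff_isRoot_charpoly L μ).1 hμ)
  have hall : ∀ z ∈ L.charpoly.roots, ‖z‖ ≤ 1 := fun z hz =>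
    hle z ((Module.End.hasEigenvalue_iff_isRoot_charpoly L z).2 ((Polynomial.mem_roots hne).1 hz))
  obtain ⟨t, ht⟩ := Multiset.exists_cons_of_mem hmem
  have h1 : ‖t.prod‖ ≤ 1 := aux_prod t fun z hz => hall z (ht ▸ Multiset.mem_cons_of_mem hz)
  rw [ht, Multiset.prod_cons, norm_mul] at hdet'
  refine le_antisymm (hle μ hμ) ?_
  nlinarith [norm_nonneg μ]
end
end
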